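/- arXiv:1011.4216 — 6 statements merged into one kernel-verified Lean document; each statement's English description precedes it below -/
import Mathlib

section
/- Let M be a finite set-homogeneous a-digraph which is connected, and suppose there are distinct vertices α, β of M with Γ(α) = Γ(β). Then M is isomorphic to D_3[K̄_n] for some n ≥ 2. -/
/-- An a-digraph structure: a binary arc relation on the vertex type. -/
structure ADigraph (V : Type*) where
  arc : V → V → Prop

namespace ADigraph

variable {V W : Type*}

/-- The a-digraph axioms: the arc relation is irreflexive and antisymmetric
(no loops, and never arcs in both directions between two vertices). -/
def IsA (M : ADigraph V) : Prop :=
  (∀ v, ¬ M.arc v v) ∧ ∀ u v, M.arc u v → ¬ M.arc v u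

/-- Isomorphism of a-digraphs. -/
def Iso (M : ADigraph V) (N : ADigraph W) : Prop :=
  ∃ e : V ≃ W, ∀ u v, M.arc u v ↔ N.arc (e u) (e v)

/-- Induced subdigraph on a set of vertices. -/
def induce (M : ADigraph V) (S : Set V) : ADigraph S :=
  ⟨fun u v => M.arc (u : V) (v : V)⟩

/-- `g` is an automorphism of `M`. -/
def IsAuto (M : ADigraph V) (g : V ≃ V) : Prop :=
  ∀ u v, M.arc u v ↔ M.arc (g u) (g v)

/-- `M` is set-homogeneous: whenever two finite sets of vertices induce
isomorphic subdigraphs, some automorphism maps one set onto the other. -/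
def SetHomogeneous (M : ADigraph V) : Prop :=
  ∀ U U' : Set V, U.Finite → U'.Finite → (M.induce U).Iso (M.induce U') →
    ∃ g : V ≃ V, M.IsAuto g ∧ ⇑g '' U = U'

/-- `M` is homogeneous: every isomorphism between finite induced subdigraphs
extends to an automorphism. -/
def Homogeneous (M : ADigraph V) : Prop :=
  ∀ U U' : Set V, U.Finite → U'.Finite → ∀ e : U ≃ U',
    (∀ u v : U, M.arc (u : V) (v : V) ↔ M.arc (e u : V) (e v : V)) →
    ∃ g : V ≃ V, M.IsAuto g ∧ ∀ u : U, g (u : V) = (e u : V)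

/-- `M` is `k`-homogeneous: every isomorphism between induced subdigraphs of
size `k` extends to an automorphism. -/
def KHomogeneous (M : ADigraph V) (k : ℕ) : Prop :=
  ∀ U U' : Set V, U.Finite → U'.Finite → U.ncard = k → U'.ncard = k →
    ∀ e : U ≃ U',
      (∀ u v : U, M.arc (u : V) (v : V) ↔ M.arc (e u : V) (e v : V)) →
      ∃ g : V ≃ V, M.IsAuto g ∧ ∀ u : U, g (u : V) = (e u : V)

/-- The directed `n`-cycle `D_n`: vertices `ZMod n`, arcs `i → i + 1`.
(For `n = 1` this is a single vertex with no arcs.) -/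
def dirCycle (n : ℕ) : ADigraph (ZMod n) :=
  ⟨fun i j => j = i + 1 ∧ i ≠ j⟩

/-- `K̄_n`: the a-digraph on `n` vertices with no arcs. -/
def kbar (n : ℕ) : ADigraph (Fin n) :=
  ⟨fun _ _ => False⟩

/-- The a-digraph with no arcs on an arbitrary vertex type. -/
def kbarOn (N : Type*) : ADigraph N :=
  ⟨fun _ _ => False⟩

/-- The compositional product `M[N]`. -/
def comp (M : ADigraph V) (N : ADigraph W) : ADigraph (V × W) :=
  ⟨fun p q => M.arc p.1 q.1 ∨ (p.1 = q.1 ∧ N.arc p.2 q.2)⟩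

/-- `M` is connected: any two vertices are joined by a path of arcs,
ignoring orientation. -/
def Connected (M : ADigraph V) : Prop :=
  ∀ u v : V, Relation.ReflTransGen (fun a b => M.arc a b ∨ M.arc b a) u v

/-- `H₀`: vertices the 8 nonzero vectors of `GF(3)²`, with an arc `u → v` iff
the determinant of the `2 × 2` matrix with columns `u`, `v` equals `1`. -/
def H0 : ADigraph {v : Fin 2 → ZMod 3 // v ≠ 0} :=
  ⟨fun u v => u.1 0 * v.1 1 - u.1 1 * v.1 0 = 1⟩

end ADigraph

open ADigraph

namespace ADigraph

variable {V : Type*}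

/-- Any two distinct vertices of `S` are joined by an arc. -/
def IsTournamentOn (M : ADigraph V) (S : Finset V) : Prop :=
  ∀ u ∈ S, ∀ v ∈ S, u ≠ v → M.arc u v ∨ M.arc v u

/-- `f` preserves and reflects arcs between vertices of `U`. -/
def ArcPreservingOn (M : ADigraph V) (f : V → V) (U : Set V) : Prop :=
  ∀ u ∈ U, ∀ v ∈ U, (M.arc u v ↔ M.arc (f u) (f v))

/-- The subdigraph induced on `S` is set-homogeneous, expressed through self-maps of the
ambient vertex type. -/
def SetHomogeneousOn (M : ADigraph V) (S : Finset V) : Prop :=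
  ∀ (U : Set V) (f : V → V), U ⊆ S → Set.MapsTo f U S → M.ArcPreservingOn f U →
    ∃ g : V → V, M.ArcPreservingOn g S ∧ Set.MapsTo g S S ∧ g '' U = f '' U

/-- The a-digraph with all arcs reversed. -/
def reverse (M : ADigraph V) : ADigraph V :=
  ⟨fun u v => M.arc v u⟩

theorem IsA.reverse {M : ADigraph V} (h : M.IsA) : M.reverse.IsA :=
  ⟨h.1, fun u v huv => h.2 v u huv⟩

theorem IsTournamentOn.reverse {M : ADigraph V} {S : Finset V} (h : M.IsTournamentOn S) :
    M.reverse.IsTournamentOn S :=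
  fun u hu v hv huv => (h u hu v hv huv).symm

theorem ArcPreservingOn.reverse {M : ADigraph V} {f : V → V} {U : Set V}
    (h : M.ArcPreservingOn f U) : M.reverse.ArcPreservingOn f U :=
  fun u hu v hv => h v hv u hu

theorem SetHomogeneousOn.reverse {M : ADigraph V} {S : Finset V} (h : M.SetHomogeneousOn S) :
    M.reverse.SetHomogeneousOn S := by
  intro U f hU hf hfa
  obtain ⟨g, hg, hgS, hgU⟩ := h U f hU hf hfa.reverse
  exact ⟨g, hg.reverse, hgS, hgU⟩

theorem IsTournamentOn.mono {M : ADigraph V} {S T : Finset V} (h : M.IsTournamentOn S)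
    (hTS : T ⊆ S) : M.IsTournamentOn T :=
  fun u hu v hv => h u (hTS hu) v (hTS hv)

theorem IsTournamentOn.injOn {M : ADigraph V} (hM : M.IsA) {S : Finset V}
    (hS : M.IsTournamentOn S) {U : Set V} (hU : U ⊆ S) {f : V → V}
    (hf : M.ArcPreservingOn f U) : Set.InjOn f U := by
  intro u hu v hv huv
  by_contra hne
  rcases hS u (hU hu) v (hU hv) hne with h | h
  · exact hM.1 (f v) (huv ▸ (hf u hu v hv).1 h)
  · exact hM.1 (f v) (huv ▸ (hf v hv u hu).1 h)

open Classical in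
/-- The out-neighbours of `x` that lie in `S`. -/
noncomputable def outOn (M : ADigraph V) (S : Finset V) (x : V) : Finset V :=
  S.filter (M.arc x)

theorem mem_outOn {M : ADigraph V} {S : Finset V} {x y : V} :
    y ∈ M.outOn S x ↔ y ∈ S ∧ M.arc x y := by
  simp [outOn]

theorem outOn_subset (M : ADigraph V) (S : Finset V) (x : V) : M.outOn S x ⊆ S :=
  fun _ hy => (mem_outOn.1 hy).1

theorem SetHomogeneousOn.outOn {M : ADigraph V} (hM : M.IsA) {S : Finset V}
    (h : M.SetHomogeneousOn S) {x : V} (hx : x ∈ S) : M.SetHomogeneousOn (M.outOn S x) := by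
  classical
  intro U f hU hf hfa
  have hxU : ∀ u ∈ U, M.arc x u := fun u hu => (mem_outOn.1 (hU hu)).2
  have hxf : ∀ u ∈ U, M.arc x (f u) := fun u hu => (mem_outOn.1 (hf hu)).2
  have hne : ∀ u ∈ U, u ≠ x := fun u hu e => hM.1 x (e ▸ hxU u hu)
  set f' := Function.update f x x with hf'
  have f'x : f' x = x := by simp [hf']
  have f'u : ∀ u ∈ U, f' u = f u := fun u hu => by simp [hf', hne u hu]
  obtain ⟨g, hg, hgS, hgU⟩ := h (insert x U) f'
    (Set.insert_subset hx fun u hu => M.outOn_subset S x (hU hu))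
    (by
      rintro u (rfl | hu)
      · rwa [f'x]
      · rw [f'u u hu]
        exact M.outOn_subset S x (hf hu))
    (by
      rintro u (rfl | hu) v (rfl | hv)
      · rw [f'x]
      · simp [f'x, f'u v hv, hxU v hv, hxf v hv]
      · rw [f'x, f'u u hu]
        exact iff_of_false (hM.2 _ _ (hxU u hu)) (hM.2 _ _ (hxf u hu))
      · rw [f'u u hu, f'u v hv]
        exact hfa u hu v hv)
  rw [Set.image_insert_eq, Set.image_insert_eq, f'x, Set.image_congr f'u] at hgU
  have hgx : g x = x := by
    have h1 : g x ∈ insert x (f '' U) := hgU ▸ Set.mem_insert _ _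
    have h2 : x ∈ insert (g x) (g '' U) := hgU ▸ Set.mem_insert _ _
    rcases h1 with h1 | ⟨u, hu, h1⟩
    · exact h1
    rcases h2 with h2 | ⟨w, hw, h2⟩
    · exact h2.symm
    have h3 := (hg x hx w (M.outOn_subset S x (hU hw))).1 (hxU w hw)
    rw [h2, ← h1] at h3
    exact absurd (hxf u hu) (hM.2 _ _ h3)
  have hgA : ∀ u ∈ M.outOn S x, M.arc x (g u) := fun u hu => by
    have := (hg x hx u (M.outOn_subset S x hu)).1 (mem_outOn.1 hu).2
    rwa [hgx] at this
  refine ⟨g, fun u hu v hv => hg u (M.outOn_subset S x hu) v (M.outOn_subset S x hv),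
    fun u hu => mem_outOn.2 ⟨hgS (M.outOn_subset S x hu), hgA u hu⟩, ?_⟩
  have hx1 : x ∉ g '' U := by
    rintro ⟨u, hu, e⟩
    exact hM.1 x (by simpa [e] using hgA u (hU hu))
  have hx2 : x ∉ f '' U := by
    rintro ⟨u, hu, e⟩
    exact hM.1 x (by simpa [e] using hxf u hu)
  rw [hgx] at hgU
  rw [← Set.insert_sdiff_self_of_notMem hx1, hgU, Set.insert_sdiff_self_of_notMem hx2]

theorem card_outOn_le {M : ADigraph V} (hM : M.IsA) {S : Finset V} (hS : M.IsTournamentOn S)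
    (h : M.SetHomogeneousOn S) {x y : V} (hx : x ∈ S) (hy : y ∈ S) :
    (M.outOn S x).card ≤ (M.outOn S y).card := by
  obtain ⟨g, hg, hgS, hgU⟩ := h {x} (fun _ => y) (by simpa using hx) (fun _ _ => hy)
    (by
      rintro u rfl v rfl
      exact iff_of_false (hM.1 _) (hM.1 _))
  have hgx : g x = y := by simpa using hgU
  refine Finset.card_le_card_of_injOn g (fun u hu => ?_)
    ((hS.injOn hM subset_rfl hg).mono (M.outOn_subset S x))
  have hu := mem_outOn.1 hu
  exact mem_outOn.2 ⟨hgS hu.1, hgx ▸ (hg x hx u hu.1).1 hu.2⟩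

theorem card_outOn_eq {M : ADigraph V} (hM : M.IsA) {S : Finset V} (hS : M.IsTournamentOn S)
    (h : M.SetHomogeneousOn S) {x y : V} (hx : x ∈ S) (hy : y ∈ S) :
    (M.outOn S x).card = (M.outOn S y).card :=
  (card_outOn_le hM hS h hx hy).antisymm (card_outOn_le hM hS h hy hx)

theorem card_outOn_reverse {M : ADigraph V} (hM : M.IsA) {S : Finset V}
    (hS : M.IsTournamentOn S) (h : M.SetHomogeneousOn S) {x : V} (hx : x ∈ S) :
    (M.reverse.outOn S x).card = (M.outOn S x).card := by
  classical
  have key : ∑ y ∈ S, (M.outOn S y).card = ∑ y ∈ S, (M.reverse.outOn S y).card := by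
    have := Finset.sum_card_bipartiteAbove_eq_sum_card_bipartiteBelow (s := S) (t := S) M.arc
    unfold Finset.bipartiteAbove Finset.bipartiteBelow at this
    exact this
  rw [Finset.sum_congr rfl fun y hy => card_outOn_eq hM hS h hy hx,
    Finset.sum_congr rfl fun y hy => card_outOn_eq hM.reverse hS.reverse h.reverse hy hx,
    Finset.sum_const, Finset.sum_const, smul_eq_mul, smul_eq_mul] at key
  exact (Nat.eq_of_mul_eq_mul_left (Finset.card_pos.2 ⟨x, hx⟩) key).symm

theorem card_eq_two_mul_card_outOn_add_one {M : ADigraph V} (hM : M.IsA) {S : Finset V}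
    (hS : M.IsTournamentOn S) (h : M.SetHomogeneousOn S) {x : V} (hx : x ∈ S) :
    S.card = 2 * (M.outOn S x).card + 1 := by
  classical
  have hd : Disjoint (M.outOn S x) (M.reverse.outOn S x) :=
    Finset.disjoint_left.2 fun y h1 h2 => hM.2 _ _ (mem_outOn.1 h1).2 (mem_outOn.1 h2).2
  have hxn : x ∉ M.outOn S x ∪ M.reverse.outOn S x := by
    rw [Finset.mem_union, mem_outOn, mem_outOn]
    rintro (h | h)
    · exact hM.1 x h.2
    · exact hM.1 x h.2
  have hSe : S = insert x (M.outOn S x ∪ M.reverse.outOn S x) := by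
    ext y
    simp only [Finset.mem_insert, Finset.mem_union, mem_outOn]
    constructor
    · intro hy
      by_cases hyx : y = x
      · exact Or.inl hyx
      · exact Or.inr ((hS x hx y hy (Ne.symm hyx)).imp (⟨hy, ·⟩) (⟨hy, ·⟩))
    · rintro (rfl | h | h)
      · exact hx
      · exact h.1
      · exact h.1
  have hc := congrArg Finset.card hSe
  rw [Finset.card_insert_of_notMem hxn, Finset.card_union_of_disjoint hd,
    card_outOn_reverse hM hS h hx] at hc
  lia

open Classical in
theorem exists_cycle_of_card_eq_three {M : ADigraph V} (hM : M.IsA) {S : Finset V}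
    (hS : M.IsTournamentOn S) (h : M.SetHomogeneousOn S) (hc : S.card = 3) :
    ∃ a b c, S = {a, b, c} ∧ M.arc a b ∧ M.arc b c ∧ M.arc c a := by
  have hout : ∀ x ∈ S, ∃ y, M.outOn S x = {y} := fun x hx =>
    Finset.card_eq_one.1 (by have := card_eq_two_mul_card_outOn_add_one hM hS h hx; lia)
  obtain ⟨a, ha⟩ : S.Nonempty := Finset.card_pos.1 (by lia)
  obtain ⟨b, hab⟩ := hout a ha
  obtain ⟨hb, hab'⟩ := mem_outOn.1 (hab ▸ Finset.mem_singleton_self b)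
  obtain ⟨c, hbc⟩ := hout b hb
  obtain ⟨hcS, hbc'⟩ := mem_outOn.1 (hbc ▸ Finset.mem_singleton_self c)
  have hne1 : a ≠ b := fun e => hM.1 b (e ▸ hab')
  have hne2 : b ≠ c := fun e => hM.1 c (e ▸ hbc')
  have hne3 : a ≠ c := fun e => hM.2 _ _ hab' (e ▸ hbc')
  refine ⟨a, b, c, ?_, hab', hbc', ?_⟩
  · refine (Finset.eq_of_subset_of_card_le ?_ ?_).symm
    · simp [Finset.insert_subset_iff, ha, hb, hcS]
    · rw [hc, Finset.card_eq_three.2 ⟨a, b, c, hne1, hne3, hne2, rfl⟩]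
  · refine (hS a ha c hcS hne3).resolve_left fun hac => hne2 ?_
    have : c ∈ M.outOn S a := mem_outOn.2 ⟨hcS, hac⟩
    rw [hab, Finset.mem_singleton] at this
    exact this.symm

theorem exists_arcPreservingOn_of_cycles {M : ADigraph V} (hM : M.IsA) {a b c a' b' c' : V}
    (hab : M.arc a b) (hbc : M.arc b c) (hca : M.arc c a)
    (hab' : M.arc a' b') (hbc' : M.arc b' c') (hca' : M.arc c' a') :
    ∃ f : V → V, M.ArcPreservingOn f {a, b, c} ∧ f '' {a, b, c} = {a', b', c'} := by
  classical
  have h1 : b ≠ a := fun e => hM.1 a (by simpa [e] using hab)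
  have h2 : c ≠ b := fun e => hM.1 b (by simpa [e] using hbc)
  have h3 : c ≠ a := fun e => hM.1 a (by simpa [e] using hca)
  refine ⟨fun v => if v = a then a' else if v = b then b' else c', ?_, ?_⟩
  · rintro u (rfl | rfl | rfl) v (rfl | rfl | rfl) <;>
      simp [h1, h2, h3, hM.1, hab, hbc, hca, hab', hbc', hca', hM.2 _ _ hab, hM.2 _ _ hbc,
        hM.2 _ _ hca, hM.2 _ _ hab', hM.2 _ _ hbc', hM.2 _ _ hca']
  · simp [Set.image_insert_eq, h1, h2, h3]

/-- In a set-homogeneous tournament, out-degrees are never three. -/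
theorem card_outOn_ne_three {M : ADigraph V} (hM : M.IsA) {S : Finset V}
    (hS : M.IsTournamentOn S) (h : M.SetHomogeneousOn S) {x : V} (hx : x ∈ S) :
    (M.outOn S x).card ≠ 3 := by
  intro hA
  have hB := (card_outOn_reverse hM hS h hx).trans hA
  have hAS := M.outOn_subset S x
  have hBS := M.reverse.outOn_subset S x
  have hAT := hS.mono hAS
  have hAH := h.outOn hM hx
  obtain ⟨a, b, c, hAe, hab, hbc, hca⟩ := exists_cycle_of_card_eq_three hM hAT hAH hA
  obtain ⟨a', b', c', hBe, hab', hbc', hca'⟩ := exists_cycle_of_card_eq_three hM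
    (hS.mono hBS) (h.reverse.outOn hM.reverse hx).reverse hB
  obtain ⟨f, hf, hfi⟩ := exists_arcPreservingOn_of_cycles hM hab hbc hca hab' hbc' hca'
  have hAe' : ({a, b, c} : Set V) = M.outOn S x := by rw [hAe]; simp
  have hBe' : ({a', b', c'} : Set V) = M.reverse.outOn S x := by rw [hBe]; simp
  rw [hAe'] at hf hfi
  rw [hBe'] at hfi
  obtain ⟨g, hg, hgS, hgA⟩ := h _ f hAS (fun u hu => hBS (by
    rw [← Finset.mem_coe, ← hfi]
    exact Set.mem_image_of_mem f hu)) hf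
  rw [hfi] at hgA
  have hgx : ∀ z ∈ M.reverse.outOn S x, M.arc (g x) z := by
    intro z hz
    rw [← Finset.mem_coe, ← hgA] at hz
    obtain ⟨u, hu, rfl⟩ := hz
    exact (hg x hx u (hAS hu)).1 (mem_outOn.1 hu).2
  have hyS : g x ∈ S := hgS hx
  have hyx : x ≠ g x := by
    intro e
    obtain ⟨z, hz⟩ : (M.reverse.outOn S x).Nonempty := Finset.card_pos.1 (by lia)
    exact hM.2 _ _ (hgx z hz) (e ▸ (mem_outOn.1 hz).2)
  have hyA : g x ∈ M.outOn S x := by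
    refine mem_outOn.2 ⟨hyS, (hS x hx _ hyS hyx).resolve_right fun hy => ?_⟩
    exact hM.1 _ (hgx (g x) (mem_outOn.2 ⟨hyS, hy⟩))
  have hout : M.reverse.outOn S x = M.outOn S (g x) :=
    Finset.eq_of_subset_of_card_le
      (fun z hz => mem_outOn.2 ⟨hBS hz, hgx z hz⟩)
      (by rw [hB, ← hA, card_outOn_eq hM hS h hx hyS])
  have hk := card_eq_two_mul_card_outOn_add_one hM hAT hAH hyA
  obtain ⟨z, hz⟩ : (M.outOn (M.outOn S x) (g x)).Nonempty := Finset.card_pos.1 (by lia)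
  obtain ⟨hzA, hyz⟩ := mem_outOn.1 hz
  have hzB : z ∈ M.reverse.outOn S x := hout ▸ mem_outOn.2 ⟨hAS hzA, hyz⟩
  exact hM.2 _ _ (mem_outOn.1 hzA).2 (mem_outOn.1 hzB).2

/-- A nonempty finite set-homogeneous tournament has one or three vertices. -/
theorem card_eq_one_or_three {M : ADigraph V} (hM : M.IsA) (S : Finset V)
    (hS : M.IsTournamentOn S) (h : M.SetHomogeneousOn S) (hne : S.Nonempty) :
    S.card = 1 ∨ S.card = 3 := by
  induction S using Finset.strongInduction with
  | H S ih =>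
    obtain ⟨x, hx⟩ := hne
    have hk := card_eq_two_mul_card_outOn_add_one hM hS h hx
    rcases (M.outOn S x).eq_empty_or_nonempty with he | hne
    · rw [he] at hk
      exact Or.inl (by simpa using hk)
    · have hss : M.outOn S x ⊂ S :=
        (Finset.ssubset_iff_of_subset (M.outOn_subset S x)).2
          ⟨x, hx, fun h => hM.1 x (mem_outOn.1 h).2⟩
      rcases ih _ hss (hS.mono hss.1) (h.outOn hM hx) hne with h1 | h3
      · exact Or.inr (by lia)
      · exact absurd h3 (card_outOn_ne_three hM hS h hx)

theorem SetHomogeneous.exists_isAuto {M : ADigraph V} (h : M.SetHomogeneous) {U : Set V}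
    (hU : U.Finite) {f : V → V} (hinj : Set.InjOn f U) (hf : M.ArcPreservingOn f U) :
    ∃ g : V ≃ V, M.IsAuto g ∧ g '' U = f '' U :=
  h U (f '' U) hU (hU.image f)
    ⟨hinj.bijOn_image.equiv f, fun u v => hf u u.2 v v.2⟩

theorem SetHomogeneous.exists_isAuto_apply_eq {M : ADigraph V} (hM : M.IsA)
    (h : M.SetHomogeneous) (x y : V) : ∃ g : V ≃ V, M.IsAuto g ∧ g x = y := by
  obtain ⟨g, hg, hgU⟩ := h.exists_isAuto (Set.finite_singleton x) (f := fun _ => y)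
    (Set.injOn_singleton _ _)
    (by
      rintro u rfl v rfl
      exact iff_of_false (hM.1 _) (hM.1 _))
  exact ⟨g, hg, by simpa using hgU⟩

/-- If two distinct vertices share their out-neighbourhood, then so do all non-adjacent pairs. -/
theorem SetHomogeneous.arc_eq_of_not_adj {M : ADigraph V} (hM : M.IsA)
    (h : M.SetHomogeneous) {α β : V} (hne : α ≠ β) (hαβ : M.arc α = M.arc β) {x y : V}
    (hxy : ¬ M.arc x y) (hyx : ¬ M.arc y x) : M.arc x = M.arc y := by
  classical
  rcases eq_or_ne x y with rfl | hne'
  · rfl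
  have h1 : ¬ M.arc α β := by rw [hαβ]; exact hM.1 β
  have h2 : ¬ M.arc β α := by rw [← hαβ]; exact hM.1 α
  obtain ⟨g, hg, hgU⟩ := h.exists_isAuto (U := {x, y}) (Set.toFinite _)
    (f := fun v => if v = x then α else β)
    (by
      rintro u (rfl | rfl) v (rfl | rfl) <;> simp [hne'.symm, hne, hne.symm])
    (by
      rintro u (rfl | rfl) v (rfl | rfl) <;> simp [hne'.symm, hM.1, h1, h2, hxy, hyx])
  rw [Set.image_pair, Set.image_pair] at hgU
  simp only [if_true, hne'.symm, if_false] at hgU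
  have hgxy : M.arc (g x) = M.arc (g y) := by
    have hx : g x ∈ ({α, β} : Set V) := hgU ▸ Set.mem_insert _ _
    have hy : g y ∈ ({α, β} : Set V) := hgU ▸ Set.mem_insert_of_mem _ rfl
    rcases hx with hx | hx <;> rcases hy with hy | hy <;> rw [hx, hy] <;> simp [hαβ]
  funext z
  exact propext ((hg x z).trans (by rw [hgxy, ← hg y z]))

/-- The chosen vertex with the same out-neighbourhood as `v`. -/
noncomputable def rep (M : ADigraph V) (v : V) : V :=
  haveI : Nonempty V := ⟨v⟩
  Function.invFun M.arc (M.arc v)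

theorem arc_rep (M : ADigraph V) (v : V) : M.arc (M.rep v) = M.arc v :=
  haveI : Nonempty V := ⟨v⟩
  Function.invFun_eq (f := M.arc) ⟨v, rfl⟩

theorem rep_eq_rep {M : ADigraph V} {u v : V} (h : M.arc u = M.arc v) : M.rep u = M.rep v := by
  unfold rep
  rw [h]

theorem rep_rep (M : ADigraph V) (v : V) : M.rep (M.rep v) = M.rep v :=
  rep_eq_rep (M.arc_rep v)

theorem arc_rep_right {M : ADigraph V} (hM : M.IsA)
    (hE : ∀ x y, ¬ M.arc x y → ¬ M.arc y x → M.arc x = M.arc y) (u v : V) :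
    M.arc u (M.rep v) ↔ M.arc u v := by
  have key : ∀ v w, M.arc v = M.arc w → M.arc u v → M.arc u w := by
    intro v w hvw huv
    by_contra hn
    have hwu : ¬ M.arc w u := by rw [← hvw]; exact hM.2 _ _ huv
    have huw := hE u w hn hwu
    rw [huw, ← hvw] at huv
    exact hM.1 v huv
  exact ⟨key _ _ (M.arc_rep v), key _ _ (M.arc_rep v).symm⟩

theorem arc_rep_rep {M : ADigraph V} (hM : M.IsA)
    (hE : ∀ x y, ¬ M.arc x y → ¬ M.arc y x → M.arc x = M.arc y) (u v : V) :
    M.arc (M.rep u) (M.rep v) ↔ M.arc u v := by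
  rw [M.arc_rep, arc_rep_right hM hE]

open Classical in
theorem isTournamentOn_image_rep [Fintype V] {M : ADigraph V}
    (hE : ∀ x y, ¬ M.arc x y → ¬ M.arc y x → M.arc x = M.arc y) :
    M.IsTournamentOn (Finset.univ.image M.rep) := by
  intro u hu v hv huv
  obtain ⟨u, -, rfl⟩ := Finset.mem_image.1 hu
  obtain ⟨v, -, rfl⟩ := Finset.mem_image.1 hv
  by_contra! hn
  have := rep_eq_rep (hE _ _ hn.1 hn.2)
  rw [rep_rep, rep_rep] at this
  exact huv this

open Classical in
theorem SetHomogeneous.setHomogeneousOn_image_rep [Fintype V] {M : ADigraph V} (hM : M.IsA)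
    (h : M.SetHomogeneous)
    (hE : ∀ x y, ¬ M.arc x y → ¬ M.arc y x → M.arc x = M.arc y) :
    M.SetHomogeneousOn (Finset.univ.image M.rep) := by
  intro U f hU hf hfa
  obtain ⟨g, hg, hgU⟩ := h.exists_isAuto U.toFinite
    ((isTournamentOn_image_rep hE).injOn hM hU hfa) hfa
  refine ⟨M.rep ∘ g, fun u _ v _ => (hg u v).trans (arc_rep_rep hM hE _ _).symm,
    fun u _ => by simp, ?_⟩
  rw [Set.image_comp, hgU, ← Set.image_comp]
  refine Set.image_congr fun u hu => ?_
  obtain ⟨w, -, hw⟩ := Finset.mem_image.1 (hf hu)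
  rw [Function.comp_apply, ← hw, rep_rep]

/-- A colouring by `ZMod 3` along which the arcs are exactly the steps `i → i + 1` exhibits a
vertex-transitive a-digraph as `D₃[K̄_n]`. -/
theorem iso_comp_of_coloring [Fintype V] {M : ADigraph V}
    (htrans : ∀ x y, ∃ g : V ≃ V, M.IsAuto g ∧ g x = y) {c : V → ZMod 3}
    (hc : ∀ u v, M.arc u v ↔ c v = c u + 1) (hsurj : Function.Surjective c) :
    M.Iso ((dirCycle 3).comp (kbar (Nat.card {v // c v = 0}))) := by
  have hsame : ∀ u v, c u = c v ↔ ¬ M.arc u v ∧ ¬ M.arc v u := by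
    intro u v
    rw [hc, hc]
    generalize c u = i
    generalize c v = j
    revert i j
    decide
  have hcard : ∀ i, Nonempty ({v // c v = i} ≃ Fin (Nat.card {v // c v = 0})) := by
    intro i
    obtain ⟨x, hx⟩ := hsurj i
    obtain ⟨y, hy⟩ := hsurj 0
    obtain ⟨g, hg, hgx⟩ := htrans x y
    have e : {v // c v = i} ≃ {v // c v = 0} := g.subtypeEquiv fun v => by
      rw [← hx, ← hy, ← hgx, hsame, hsame, hg v x, hg x v]
    exact ⟨e.trans (Finite.equivFin _)⟩
  let e : ∀ i, {v // c v = i} ≃ Fin (Nat.card {v // c v = 0}) := fun i => (hcard i).some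
  refine ⟨(Equiv.sigmaFiberEquiv c).symm.trans
    ((Equiv.sigmaCongrRight e).trans (Equiv.sigmaEquivProd _ _)), fun u v => (hc u v).trans ?_⟩
  have hstep : ∀ i j : ZMod 3, j = i + 1 → i ≠ j := by decide
  simp only [comp, dirCycle, kbar, and_false, or_false]
  exact ⟨fun h => ⟨h, hstep _ _ h⟩, fun h => h.1⟩

open Classical in
theorem exists_coloring_of_cycle [Fintype V] {M : ADigraph V} (hM : M.IsA)
    (hE : ∀ x y, ¬ M.arc x y → ¬ M.arc y x → M.arc x = M.arc y) {a b d : V}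
    (hS : Finset.univ.image M.rep = {a, b, d})
    (hab : M.arc a b) (hbd : M.arc b d) (hda : M.arc d a) :
    ∃ c : V → ZMod 3, (∀ u v, M.arc u v ↔ c v = c u + 1) ∧ Function.Surjective c := by
  have hrep : ∀ v, M.rep v = a ∨ M.rep v = b ∨ M.rep v = d := fun v => by
    have : M.rep v ∈ Finset.univ.image M.rep := Finset.mem_image_of_mem _ (Finset.mem_univ v)
    simpa [hS] using this
  have hfix : ∀ x ∈ ({a, b, d} : Finset V), M.rep x = x := fun x hx => by
    rw [← hS] at hx
    obtain ⟨w, -, rfl⟩ := Finset.mem_image.1 hx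
    exact M.rep_rep w
  have h1 : b ≠ a := fun e => hM.1 a (by simpa [e] using hab)
  have h2 : d ≠ b := fun e => hM.1 b (by simpa [e] using hbd)
  have h3 : d ≠ a := fun e => hM.1 a (by simpa [e] using hda)
  have e1 : (1 : ZMod 3) + 1 = 2 := by decide
  have e2 : (2 : ZMod 3) + 1 = 0 := by decide
  have e3 : (0 : ZMod 3) ≠ 1 := by decide
  have e4 : (0 : ZMod 3) ≠ 2 := by decide
  have e5 : (1 : ZMod 3) ≠ 2 := by decide
  refine ⟨fun v => if M.rep v = a then 0 else if M.rep v = b then 1 else 2, fun u v => ?_, ?_⟩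
  · rw [← arc_rep_rep hM hE]
    rcases hrep u with hu | hu | hu <;> rcases hrep v with hv | hv | hv <;>
      simp [hu, hv, h1, h2, h3, hM.1, hab, hbd, hda, hM.2 _ _ hab, hM.2 _ _ hbd,
        hM.2 _ _ hda, e1, e2, e3, e4, e5, e3.symm, e4.symm, e5.symm]
  · have hcases : ∀ i : ZMod 3, i = 0 ∨ i = 1 ∨ i = 2 := by decide
    intro i
    rcases hcases i with rfl | rfl | rfl
    · exact ⟨a, by simp [hfix a]⟩
    · exact ⟨b, by simp [hfix b, h1]⟩
    · exact ⟨d, by simp [hfix d, h2, h3]⟩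

end ADigraph

/-- A finite connected set-homogeneous a-digraph with two
distinct vertices having the same out-neighbourhood is isomorphic to
`D₃[K̄_n]` for some `n ≥ 2`. -/
theorem finite_set_homogeneous_adigraph_same_out_nbhd
    {V : Type} [Fintype V] (M : ADigraph V) (hM : M.IsA)
    (hsh : M.SetHomogeneous) (hconn : M.Connected)
    (α β : V) (hne : α ≠ β)
    (hΓ : {x | M.arc α x} = {x | M.arc β x}) :
    ∃ n : ℕ, 2 ≤ n ∧ M.Iso ((dirCycle 3).comp (kbar n)) := by
  classical
  have hαβ : M.arc α = M.arc β := hΓ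
  have hE : ∀ x y, ¬ M.arc x y → ¬ M.arc y x → M.arc x = M.arc y := fun _ _ =>
    hsh.arc_eq_of_not_adj hM hne hαβ
  have htrans := hsh.exists_isAuto_apply_eq hM
  have hST := isTournamentOn_image_rep hE
  have hSH := hsh.setHomogeneousOn_image_rep hM hE
  have hne1 : (Finset.univ.image M.rep).card ≠ 1 := by
    intro h1
    obtain ⟨z, hz⟩ := Finset.card_eq_one.1 h1
    have hrep : ∀ v, M.rep v = z := fun v => by
      have : M.rep v ∈ Finset.univ.image M.rep := Finset.mem_image_of_mem _ (Finset.mem_univ v)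
      simpa [hz] using this
    have hno : ∀ u v, ¬ M.arc u v := fun u v huv => by
      rw [← arc_rep_rep hM hE, hrep, hrep] at huv
      exact hM.1 z huv
    rcases (hconn α β).cases_head with h | ⟨w, h | h, -⟩
    · exact hne h
    · exact hno _ _ h
    · exact hno _ _ h
  have h3 := (card_eq_one_or_three hM _ hST hSH
    ⟨M.rep α, Finset.mem_image_of_mem _ (Finset.mem_univ α)⟩).resolve_left hne1
  obtain ⟨a, b, d, hS, hab, hbd, hda⟩ := exists_cycle_of_card_eq_three hM hST hSH h3
  obtain ⟨c, hc, hsurj⟩ := exists_coloring_of_cycle hM hE hS hab hbd hda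
  obtain ⟨e, he⟩ := iso_comp_of_coloring htrans hc hsurj
  refine ⟨_, ?_, e, he⟩
  by_contra! hlt
  have hfst : (e α).1 = (e β).1 := by
    have hstep : ∀ i : ZMod 3, i ≠ i + 1 := by decide
    have h1 : M.arc α (e.symm ((e α).1 + 1, (e α).2)) := by
      rw [he, Equiv.apply_symm_apply]
      exact Or.inl ⟨rfl, hstep _⟩
    rw [hαβ, he, Equiv.apply_symm_apply] at h1
    rcases h1 with h1 | h1
    · exact add_right_cancel h1.1
    · exact h1.2.elim
  refine hne (e.injective (Prod.ext hfst (Fin.ext ?_)))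
  have := (e α).2.2
  have := (e β).2.2
  lia
end

section
/- Let M be a finite set-homogeneous s-digraph which is Γ-connected, and suppose there are distinct vertices α, β of M with Γ(α) = Γ(β). Then M or its complement M̄ is isomorphic to one of: L for some finite set-homogeneous graph L; D_3[L] for some finite set-homogeneous graph L; or A[K_n] for some finite set-homogeneous a-digraph A and some n > 1. -/
/-- A symmetric digraph (s-digraph): an arc relation and an edge relation on
the vertex type. -/
structure SDigraph (V : Type*) where
  arc : V → V → Prop
  edge : V → V → Prop

namespace SDigraph

variable {V W : Type*}

/-- The s-digraph axioms: arcs are irreflexive and antisymmetric, edges are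
irreflexive and symmetric, and no pair of vertices is related by both. -/
def IsS (M : SDigraph V) : Prop :=
  (∀ v, ¬ M.arc v v) ∧ (∀ u v, M.arc u v → ¬ M.arc v u) ∧
    (∀ v, ¬ M.edge v v) ∧ (∀ u v, M.edge u v → M.edge v u) ∧
    ∀ u v, M.edge u v → ¬ M.arc u v

/-- An s-digraph with no arcs is a graph. -/
def NoArcs (M : SDigraph V) : Prop := ∀ u v, ¬ M.arc u v

/-- An s-digraph with no edges is an a-digraph. -/
def NoEdges (M : SDigraph V) : Prop := ∀ u v, ¬ M.edge u v

/-- Isomorphism of s-digraphs. -/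
def Iso (M : SDigraph V) (N : SDigraph W) : Prop :=
  ∃ e : V ≃ W, (∀ u v, M.arc u v ↔ N.arc (e u) (e v)) ∧
    ∀ u v, M.edge u v ↔ N.edge (e u) (e v)

/-- Induced sub-s-digraph on a set of vertices. -/
def induce (M : SDigraph V) (S : Set V) : SDigraph S :=
  ⟨fun u v => M.arc (u : V) (v : V), fun u v => M.edge (u : V) (v : V)⟩

/-- `g` is an automorphism of `M`. -/
def IsAuto (M : SDigraph V) (g : V ≃ V) : Prop :=
  (∀ u v, M.arc u v ↔ M.arc (g u) (g v)) ∧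
    ∀ u v, M.edge u v ↔ M.edge (g u) (g v)

/-- `M` is set-homogeneous: whenever two finite sets of vertices induce
isomorphic sub-s-digraphs, some automorphism maps one set onto the other. -/
def SetHomogeneous (M : SDigraph V) : Prop :=
  ∀ U U' : Set V, U.Finite → U'.Finite → (M.induce U).Iso (M.induce U') →
    ∃ g : V ≃ V, M.IsAuto g ∧ ⇑g '' U = U'

/-- The complement of an s-digraph: arcs are reversed, and edges are
interchanged with unrelated pairs. -/
def compl (M : SDigraph V) : SDigraph V :=
  ⟨fun u v => M.arc v u,
   fun u v => u ≠ v ∧ ¬ M.edge u v ∧ ¬ M.arc u v ∧ ¬ M.arc v u⟩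

/-- The compositional product `M[N]`. -/
def comp (M : SDigraph V) (N : SDigraph W) : SDigraph (V × W) :=
  ⟨fun p q => M.arc p.1 q.1 ∨ (p.1 = q.1 ∧ N.arc p.2 q.2),
   fun p q => M.edge p.1 q.1 ∨ (p.1 = q.1 ∧ N.edge p.2 q.2)⟩

/-- Γ-connectedness: any two vertices are joined by a path of arcs
(ignoring orientation, and not using edges). -/
def GammaConnected (M : SDigraph V) : Prop :=
  ∀ u v : V, Relation.ReflTransGen (fun a b => M.arc a b ∨ M.arc b a) u v

/-- The complete graph `K_n`, as an s-digraph. -/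
def K (n : ℕ) : SDigraph (Fin n) :=
  ⟨fun _ _ => False, fun i j => i ≠ j⟩

/-- The directed triangle `D₃`, as an s-digraph. -/
def D3 : SDigraph (ZMod 3) :=
  ⟨fun i j => j = i + 1, fun _ _ => False⟩

/-- The s-digraph `E₆`: a directed 6-cycle with edges between opposite
vertices. -/
def E6 : SDigraph (ZMod 6) :=
  ⟨fun i j => j = i + 1, fun i j => j = i + 3 ∨ i = j + 3⟩

/-- The s-digraph `E₇`: a directed 7-cycle with edges `i ∼ i + 3`. -/
def E7 : SDigraph (ZMod 7) :=
  ⟨fun i j => j = i + 1, fun i j => j = i + 3 ∨ i = j + 3⟩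

/-- The s-digraph `F₆`: two directed triangles matched by edges. -/
def F6 : SDigraph (Fin 2 × ZMod 3) :=
  ⟨fun p q => p.1 = q.1 ∧ q.2 = p.2 + 1,
   fun p q => p.1 ≠ q.1 ∧ p.2 = q.2⟩

/-- The s-digraph `J_n`: three independent `n`-element blocks `B₀, B₁, B₂`
with all arcs from `B_i` to `B_{i+1}` except along the matchings, where
there are edges instead. -/
def J (n : ℕ) : SDigraph (ZMod 3 × Fin n) :=
  ⟨fun p q => q.1 = p.1 + 1 ∧ p.2 ≠ q.2,
   fun p q => p.1 ≠ q.1 ∧ p.2 = q.2⟩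

/-- The s-digraph `H₁` on 8 vertices (vertices `0`–`7` here standing for
`1`–`8`). -/
def H1 : SDigraph (Fin 8) :=
  ⟨fun p q => (p, q) ∈
      ([(0, 2), (0, 5), (1, 3), (1, 4), (2, 1), (2, 6), (3, 0), (3, 7),
        (4, 0), (4, 6), (5, 1), (5, 7), (6, 3), (6, 5), (7, 2), (7, 4)] :
        List (Fin 8 × Fin 8)),
   fun p q => (p, q) ∈
      ([(0, 1), (1, 0), (2, 3), (3, 2), (4, 5), (5, 4), (6, 7), (7, 6)] :
        List (Fin 8 × Fin 8))⟩

/-- The mate of a vertex of `H₂` (the unique vertex joined to it by an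
edge). -/
def mate (v : Fin 12) : Fin 12 :=
  if v.val % 2 = 0 then v + 1 else v - 1

/-- The twelve basic arcs of `H₂` (vertices `0`–`11` standing for `1`–`12`). -/
def H2Base : List (Fin 12 × Fin 12) :=
  [(0, 11), (0, 9), (1, 4), (2, 1), (3, 4), (3, 6),
   (5, 6), (7, 8), (8, 5), (10, 7), (10, 9), (11, 2)]

/-- The arcs of `H₂`: the closure of the basic arcs under the rules
"if `v → w` then `w → v′`" and "if `w → v` then `v′ → w`", where `v′` denotes
the mate of `v`. -/
inductive H2Arc : Fin 12 → Fin 12 → Prop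
  | base (p q : Fin 12) : (p, q) ∈ H2Base → H2Arc p q
  | fwd (p q : Fin 12) : H2Arc p q → H2Arc q (mate p)
  | bwd (p q : Fin 12) : H2Arc p q → H2Arc (mate q) p

/-- The s-digraph `H₂` on 12 vertices. -/
def H2 : SDigraph (Fin 12) :=
  ⟨H2Arc, fun p q => q = mate p⟩

/-- The s-digraph `H₃` on the 27 vertices `GF(3)² × GF(3)`: an edge
`(u,α) ∼ (v,β)` iff `u = v` and `α ≠ β`, and an arc `(u,α) → (v,β)` iff
`u ≠ v` and `det(uᵀ vᵀ) = α - β + 1`. -/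
def H3 : SDigraph ((Fin 2 → ZMod 3) × ZMod 3) :=
  ⟨fun p q => p.1 ≠ q.1 ∧ p.1 0 * q.1 1 - p.1 1 * q.1 0 = p.2 - q.2 + 1,
   fun p q => p.1 = q.1 ∧ p.2 ≠ q.2⟩

end SDigraph

open SDigraph

/-- The possible outcomes in Lemma 3.3(ii): a graph `L`, `D₃[L]`, or
`A[K_n]` with `n > 1`. -/
def InListSameNbhd {V : Type} (N : SDigraph V) : Prop :=
  (∃ (Lt : Type) (_ : Fintype Lt) (L : SDigraph Lt),
      L.IsS ∧ L.NoArcs ∧ L.SetHomogeneous ∧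
        (N.Iso L ∨ N.Iso (D3.comp L))) ∨
  (∃ n : ℕ, 1 < n ∧ ∃ (At : Type) (_ : Fintype At) (A : SDigraph At),
      A.IsS ∧ A.NoEdges ∧ A.SetHomogeneous ∧ N.Iso (A.comp (K n)))

namespace SDigraph

variable {V W : Type*}

/-- Set-homogeneity phrased for injective families of vertices. -/
theorem SetHomogeneous.exists_auto {M : SDigraph V} (hsh : M.SetHomogeneous)
    {ι : Type*} [Finite ι] {f f' : ι → V} (hf : f.Injective) (hf' : f'.Injective)
    (harc : ∀ i j, M.arc (f i) (f j) ↔ M.arc (f' i) (f' j))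
    (hedge : ∀ i j, M.edge (f i) (f j) ↔ M.edge (f' i) (f' j)) :
    ∃ g : V ≃ V, M.IsAuto g ∧ (∀ i, ∃ j, g (f i) = f' j) ∧ ∀ j, ∃ i, g (f i) = f' j := by
  obtain ⟨g, hg, him⟩ := hsh (Set.range f) (Set.range f') (Set.finite_range f)
    (Set.finite_range f') ⟨(Equiv.ofInjective f hf).symm.trans (Equiv.ofInjective f' hf'), by
      rintro ⟨_, i, rfl⟩ ⟨_, j, rfl⟩
      simpa [induce, Equiv.ofInjective_symm_apply] using harc i j, by
      rintro ⟨_, i, rfl⟩ ⟨_, j, rfl⟩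
      simpa [induce, Equiv.ofInjective_symm_apply] using hedge i j⟩
  refine ⟨g, hg, fun i => ?_, fun j => ?_⟩
  · have : g (f i) ∈ Set.range f' := him ▸ Set.mem_image_of_mem g ⟨i, rfl⟩
    obtain ⟨j, hj⟩ := this
    exact ⟨j, hj.symm⟩
  · have : f' j ∈ g '' Set.range f := him ▸ ⟨j, rfl⟩
    obtain ⟨_, ⟨i, rfl⟩, hi⟩ := this
    exact ⟨i, hi⟩

theorem SetHomogeneous.transitive {M : SDigraph V} (hM : M.IsS) (hsh : M.SetHomogeneous)
    (u v : V) : ∃ g : V ≃ V, M.IsAuto g ∧ g u = v := by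
  obtain ⟨g, hg, h, -⟩ := hsh.exists_auto (ι := Unit) (f := fun _ => u) (f' := fun _ => v)
    (fun _ _ _ => rfl) (fun _ _ _ => rfl) (fun _ _ => by simp [hM.1])
    (fun _ _ => by simp [hM.2.2.1])
  exact ⟨g, hg, (h ()).choose_spec⟩

/-- A pair of vertices can be moved, up to a swap, to any pair of the same kind. -/
theorem SetHomogeneous.exists_auto_pair {M : SDigraph V} (hM : M.IsS) (hsh : M.SetHomogeneous)
    {a b c d : V} (hab : a ≠ b) (hcd : c ≠ d) (h₁ : M.arc a b ↔ M.arc c d)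
    (h₂ : M.arc b a ↔ M.arc d c) (h₃ : M.edge a b ↔ M.edge c d) :
    ∃ g : V ≃ V, M.IsAuto g ∧ (g a = c ∧ g b = d ∨ g a = d ∧ g b = c) := by
  obtain ⟨hirr, -, heirr, hsymm, -⟩ := hM
  have h₄ : M.edge b a ↔ M.edge d c :=
    ⟨fun h => hsymm _ _ (h₃.1 (hsymm _ _ h)), fun h => hsymm _ _ (h₃.2 (hsymm _ _ h))⟩
  obtain ⟨g, hg, h, -⟩ := hsh.exists_auto (f := ![a, b]) (f' := ![c, d])
    (by simp [Function.Injective, Fin.forall_fin_two, hab, hab.symm])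
    (by simp [Function.Injective, Fin.forall_fin_two, hcd, hcd.symm])
    (by simp [Fin.forall_fin_two, hirr, h₁, h₂]) (by simp [Fin.forall_fin_two, heirr, h₃, h₄])
  simp only [Fin.forall_fin_two, Fin.exists_fin_two, Matrix.cons_val_zero,
    Matrix.cons_val_one] at h
  have : g a ≠ g b := fun e => hab (g.injective e)
  exact ⟨g, hg, by grind⟩

theorem SetHomogeneous.exists_auto_arc {M : SDigraph V} (hM : M.IsS) (hsh : M.SetHomogeneous)
    {a b c d : V} (hab : M.arc a b) (hcd : M.arc c d) :
    ∃ g : V ≃ V, M.IsAuto g ∧ g a = c ∧ g b = d := by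
  have hne : ∀ {u v}, M.arc u v → u ≠ v := fun h e => hM.1 _ (e ▸ h)
  obtain ⟨g, hg, h | h⟩ := hsh.exists_auto_pair hM (hne hab) (hne hcd) (by simp [hab, hcd])
    (by simp [hM.2.1 _ _ hab, hM.2.1 _ _ hcd])
    ⟨fun h => (hM.2.2.2.2 _ _ h hab).elim, fun h => (hM.2.2.2.2 _ _ h hcd).elim⟩
  · exact ⟨g, hg, h⟩
  · exact (hM.2.1 _ _ hcd (h.1 ▸ h.2 ▸ (hg.1 a b).1 hab)).elim

theorem IsS.induce {M : SDigraph V} (hM : M.IsS) (C : Set V) : (M.induce C).IsS :=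
  ⟨fun _ => hM.1 _, fun _ _ => hM.2.1 _ _, fun _ => hM.2.2.1 _, fun _ _ => hM.2.2.2.1 _ _,
    fun _ _ => hM.2.2.2.2 _ _⟩

/-- An automorphism preserving `C` restricts to an automorphism of the substructure on `C`. -/
theorem IsAuto.induce {M : SDigraph V} {C : Set V} {g : V ≃ V} (hg : M.IsAuto g)
    (hC : ∀ v, v ∈ C ↔ g v ∈ C) : (M.induce C).IsAuto (g.subtypeEquiv hC) :=
  ⟨fun _ _ => hg.1 _ _, fun _ _ => hg.2 _ _⟩

/-- The out-neighbourhood of a vertex in a set-homogeneous digraph is set-homogeneous. -/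
theorem SetHomogeneous.induce_out {M : SDigraph V} (hM : M.IsS) (hE : M.NoEdges)
    (hsh : M.SetHomogeneous) (x : V) : (M.induce {y | M.arc x y}).SetHomogeneous := by
  rintro U U' hU - ⟨e, he, -⟩
  have := hU.to_subtype
  have hU1 (u : U) : M.arc x (u : {y | M.arc x y}) := u.1.2
  have hU2 (u : U') : M.arc x (u : {y | M.arc x y}) := u.1.2
  have hx1 (u : U) : x ≠ (u : {y | M.arc x y}) := fun h => hM.1 x (by simpa [← h] using hU1 u)
  have hx2 (u : U') : x ≠ (u : {y | M.arc x y}) := fun h => hM.1 x (by simpa [← h] using hU2 u)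
  obtain ⟨g, hg, h1, h2⟩ := hsh.exists_auto (ι := Option U)
    (f := fun o => o.elim x fun u => (u : {y | M.arc x y}))
    (f' := fun o => o.elim x fun u => (e u : {y | M.arc x y}))
    (by
      rintro (_ | u) (_ | v) h
      · rfl
      · exact (hx1 _ h).elim
      · exact (hx1 _ h.symm).elim
      · exact congrArg some (Subtype.ext (Subtype.ext h)))
    (by
      rintro (_ | u) (_ | v) h
      · rfl
      · exact (hx2 _ h).elim
      · exact (hx2 _ h.symm).elim
      · exact congrArg some (e.injective (Subtype.ext (Subtype.ext h))))
    (by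
      rintro (_ | u) (_ | v)
      · rfl
      · exact iff_of_true (hU1 _) (hU2 _)
      · exact iff_of_false (hM.2.1 _ _ (hU1 _)) (hM.2.1 _ _ (hU2 _))
      · exact he u v)
    (fun i j => iff_of_false (hE _ _) (hE _ _))
  have hgx : g x = x := by
    obtain ⟨_ | u, hu⟩ := h1 none
    · exact hu
    · obtain ⟨_ | v, hv⟩ := h2 none
      · exact hv
      · have h := (hg.1 _ _).1 (hU1 v)
        simp only [Option.elim] at hu hv
        rw [hu, hv] at h
        exact (hM.2.1 _ _ h (hU2 _)).elim
  have hC : ∀ v, v ∈ {y | M.arc x y} ↔ g v ∈ {y | M.arc x y} := fun v => by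
    simpa [hgx] using hg.1 x v
  refine ⟨_, hg.induce hC, ?_⟩
  ext w
  constructor
  · rintro ⟨u, hu, rfl⟩
    obtain ⟨_ | v, hv⟩ := h1 (some ⟨u, hu⟩)
    · exact (hx1 ⟨u, hu⟩ (g.injective (hgx.trans hv.symm))).elim
    · have : g.subtypeEquiv hC u = (e v : {y | M.arc x y}) := Subtype.ext hv
      rw [this]
      exact (e v).2
  · intro hw
    obtain ⟨_ | u, hu⟩ := h2 (some (e.symm ⟨w, hw⟩))
    · have h : g x = w := by simpa using hu
      exact (hx2 ⟨w, hw⟩ (hgx.symm.trans h)).elim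
    · exact ⟨u, u.2, Subtype.ext (by simpa using hu)⟩

/-- In a finite set-homogeneous tournament every out-neighbourhood has at most one vertex. -/
theorem SetHomogeneous.out_unique {V : Type} [Finite V] {A : SDigraph V} (hA : A.IsS)
    (hE : A.NoEdges) (hsh : A.SetHomogeneous) (hT : ∀ u v, u ≠ v → A.arc u v ∨ A.arc v u) :
    ∀ x y z, A.arc x y → A.arc x z → y = z := by
  induction h : Nat.card V using Nat.strong_induction_on generalizing V with
  | _ n ih =>
  intro x y z hxy hxz
  by_contra hyz
  wlog hyz' : A.arc y z generalizing y z
  · exact this z y hxz hxy (Ne.symm hyz) ((hT y z hyz).resolve_left hyz')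
  have hirr := hA.1
  have hasym := hA.2.1
  have hlt : Nat.card {v | A.arc x v} < n := by
    rw [← h]
    exact Finite.card_subtype_lt (x := x) (hirr x)
  have hsh' := hsh.induce_out hA hE x
  have huniq := ih _ hlt (hA.induce _) (fun u v => hE u v) hsh'
    (fun u v huv => hT u v fun e => huv (Subtype.ext e)) rfl
  have huniq : ∀ a b c, A.arc x a → A.arc x b → A.arc x c → A.arc a b → A.arc a c → b = c :=
    fun a b c ha hb hc hab hac =>
      congrArg Subtype.val (huniq ⟨a, ha⟩ ⟨b, hb⟩ ⟨c, hc⟩ hab hac)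
  obtain ⟨w, hxw, hzw⟩ : ∃ w, A.arc x w ∧ A.arc z w := by
    obtain ⟨g, hg, hgyz⟩ := hsh'.transitive (hA.induce _) ⟨y, hxy⟩ ⟨z, hxz⟩
    have := (hg.1 ⟨y, hxy⟩ ⟨z, hxz⟩).1 hyz'
    rw [hgyz] at this
    exact ⟨_, (g ⟨z, hxz⟩).2, this⟩
  have hwy : A.arc w y := by
    have : w ≠ y := by rintro rfl; exact hasym _ _ hyz' hzw
    refine (hT w y this).resolve_right fun hyw => ?_
    have := huniq y z w hxy hxz hxw hyz' hyw
    exact hirr _ (this ▸ hzw)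
  have hout : ∀ t, A.arc x t → t = y ∨ t = z ∨ t = w := by
    intro t ht
    by_contra! hne
    have hty : A.arc t y := (hT t y hne.1).resolve_right fun h =>
      hne.2.1 (huniq y t z hxy ht hxz h hyz')
    have htz : A.arc t z := (hT t z hne.2.1).resolve_right fun h =>
      hne.2.2 (huniq z t w hxz ht hxw h hzw)
    exact hyz (huniq t y z ht hxy hxz hty htz)
  have hne : ∀ {u v}, A.arc u v → u ≠ v := fun h e => hirr _ (e ▸ h)
  -- every directed triangle is an out-neighbourhood
  have hcyc : ∀ a b c, A.arc a b → A.arc b c → A.arc c a →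
      ∃ p, ∀ t, A.arc p t ↔ t = a ∨ t = b ∨ t = c := by
    intro a b c hab hbc hca
    obtain ⟨g, hg, h1, h2⟩ := hsh.exists_auto (f := ![y, z, w]) (f' := ![a, b, c])
      (by simp [Function.Injective, Fin.forall_fin_succ, hne hyz', hne hzw, hne hwy,
        (hne hyz').symm, (hne hzw).symm, (hne hwy).symm])
      (by simp [Function.Injective, Fin.forall_fin_succ, hne hab, hne hbc, hne hca,
        (hne hab).symm, (hne hbc).symm, (hne hca).symm])
      (by simp [Fin.forall_fin_succ, hirr, hyz', hzw, hwy, hab, hbc, hca, hasym _ _ hyz',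
        hasym _ _ hzw, hasym _ _ hwy, hasym _ _ hab, hasym _ _ hbc, hasym _ _ hca])
      (fun _ _ => iff_of_false (hE _ _) (hE _ _))
    simp only [Fin.forall_fin_succ, Fin.exists_fin_succ] at h1 h2
    simp at h1 h2
    refine ⟨g x, fun t => ?_⟩
    have hgt : A.arc (g x) t ↔ A.arc x (g.symm t) := by simp [hg.1 x]
    have hx : A.arc x (g.symm t) ↔ t = g y ∨ t = g z ∨ t = g w := by
      simp only [← Equiv.symm_apply_eq]
      exact ⟨hout _, by rintro (h | h | h) <;> rw [h] <;> assumption⟩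
    rw [hgt, hx]
    grind
  obtain ⟨p, q, hpq, hyp, hyq, hpx, hqx⟩ : ∃ p q, p ≠ q ∧ A.arc y p ∧ A.arc y q ∧
      A.arc p x ∧ A.arc q x := by
    obtain ⟨g, hg, hgxy⟩ := hsh.transitive hA x y
    have h1 := (hg.1 _ _).1 hxy
    have h2 := (hg.1 _ _).1 hxz
    have h3 := (hg.1 _ _).1 hxw
    rw [hgxy] at h1 h2 h3
    have e1 := g.injective.ne (hne hyz')
    have e2 := g.injective.ne (hne hzw)
    have e3 := g.injective.ne (hne hwy)
    have key : ∀ t, A.arc y t → t ≠ z → A.arc t x := by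
      intro t ht htz
      have htx : t ≠ x := by rintro rfl; exact hasym _ _ ht hxy
      exact (hT t x htx).resolve_right fun hxt => htz (huniq y t z hxy hxt hxz ht hyz')
    by_cases hy : g y = z
    · exact ⟨g z, g w, e2, h2, h3, key _ h2 (hy ▸ e1.symm), key _ h3 (hy ▸ e3)⟩
    · by_cases hz : g z = z
      · exact ⟨g y, g w, e3.symm, h1, h3, key _ h1 hy, key _ h3 (fun h => e2 (hz.trans h.symm))⟩
      · exact ⟨g y, g z, e1, h1, h2, key _ h1 hy, key _ h2 hz⟩
  obtain ⟨a, ha⟩ := hcyc x y p hxy hyp hpx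
  obtain ⟨b, hb⟩ := hcyc x y q hxy hyq hqx
  have hax := (ha x).2 (by simp)
  have hay := (ha y).2 (by simp)
  have hbx := (hb x).2 (by simp)
  have hby := (hb y).2 (by simp)
  have hab : a ≠ b := by
    rintro rfl
    rcases (hb p).1 ((ha p).2 (by simp)) with h | h | h
    · exact hne hpx h
    · exact hne hyp h.symm
    · exact hpq h
  rcases hT a b hab with h | h
  · rcases (ha b).1 h with h | h | h
    · exact hne hbx h
    · exact hne hby h
    · exact hasym _ _ hyp (h ▸ hby)
  · rcases (hb a).1 h with h | h | h
    · exact hne hax h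
    · exact hne hay h
    · exact hasym _ _ hyq (h ▸ hay)

/-- The equivalence relation of having the same out-neighbourhood. -/
def outSetoid (M : SDigraph V) : Setoid V where
  r u v := ∀ x, M.arc u x ↔ M.arc v x
  iseqv := ⟨fun _ _ => Iff.rfl, fun h x => (h x).symm, fun h h' x => (h x).trans (h' x)⟩

theorem outSetoid_iff {M : SDigraph V} {u v : V} :
    M.outSetoid u v ↔ ∀ x, M.arc u x ↔ M.arc v x := Iff.rfl

theorem IsAuto.outSetoid {M : SDigraph V} {g : V ≃ V} (hg : M.IsAuto g) (u v : V) :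
    M.outSetoid u v ↔ M.outSetoid (g u) (g v) := by
  simp only [outSetoid_iff]
  refine ⟨fun h x => ?_, fun h x => ?_⟩
  · simpa [hg.1 _ (g.symm x)] using h (g.symm x)
  · simpa [← hg.1] using h (g x)

theorem IsS.not_arc_of_outSetoid {M : SDigraph V} (hM : M.IsS) {u v : V}
    (h : M.outSetoid u v) : ¬ M.arc u v :=
  fun h' => hM.1 v ((h v).1 h')

/-- The a-digraph induced on the classes of vertices with the same out-neighbourhood. -/
noncomputable def outQuotient (M : SDigraph V) : SDigraph (Quotient M.outSetoid) :=
  ⟨fun p q => M.arc p.out q.out, fun _ _ => False⟩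

theorem outQuotient_isS {M : SDigraph V} (hM : M.IsS) : M.outQuotient.IsS :=
  ⟨fun _ => hM.1 _, fun _ _ => hM.2.1 _ _, fun _ => id, fun _ _ => id, fun _ _ => False.elim⟩

theorem outQuotient_arc {M : SDigraph V}
    (hin : ∀ u v w, M.outSetoid v w → M.arc u v → M.arc u w) (u v : V) :
    M.outQuotient.arc ⟦u⟧ ⟦v⟧ ↔ M.arc u v := by
  have hu : M.outSetoid (⟦u⟧ : Quotient M.outSetoid).out u := Quotient.mk_out u
  have hv : M.outSetoid (⟦v⟧ : Quotient M.outSetoid).out v := Quotient.mk_out v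
  change M.arc _ _ ↔ _
  rw [hu]
  exact ⟨hin _ _ _ hv, hin _ _ _ (M.outSetoid.symm hv)⟩

theorem outQuotient_setHomogeneous {M : SDigraph V} (hM : M.IsS) (hsh : M.SetHomogeneous)
    (hin : ∀ u v w, M.outSetoid v w → M.arc u v → M.arc u w)
    (hedge : ∀ u v, M.edge u v → M.outSetoid u v) : M.outQuotient.SetHomogeneous := by
  rintro U U' hU - ⟨e, he, -⟩
  have := hU.to_subtype
  have hout : ∀ p q : Quotient M.outSetoid, ¬ M.edge p.out q.out := by
    intro p q h
    have : p = q := Quotient.out_equiv_out.1 (hedge _ _ h)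
    subst this
    exact hM.2.2.1 _ h
  obtain ⟨g, hg, h1, h2⟩ := hsh.exists_auto (ι := U)
    (f := fun p => (p : Quotient M.outSetoid).out)
    (f' := fun p => (e p : Quotient M.outSetoid).out)
    (fun p q h => Subtype.ext (Quotient.out_inj.1 h))
    (fun p q h => e.injective (Subtype.ext (Quotient.out_inj.1 h)))
    (fun p q => he p q) (fun p q => iff_of_false (hout _ _) (hout _ _))
  refine ⟨Quotient.congr g fun u v => hg.outSetoid u v, ⟨?_, fun _ _ => Iff.rfl⟩, ?_⟩
  · rintro ⟨u⟩ ⟨v⟩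
    exact (outQuotient_arc hin u v).trans
      ((hg.1 u v).trans (outQuotient_arc hin (g u) (g v)).symm)
  have hcongr : ∀ p : Quotient M.outSetoid,
      Quotient.congr g (fun u v => hg.outSetoid u v) p = (⟦g p.out⟧ : Quotient M.outSetoid) := by
    intro p
    conv_lhs => rw [← p.out_eq]
    rfl
  ext q
  constructor
  · rintro ⟨p, hp, rfl⟩
    obtain ⟨r, hr⟩ := h1 ⟨p, hp⟩
    rw [hcongr, hr, Quotient.out_eq]
    exact (e r).2
  · intro hq
    obtain ⟨p, hp⟩ := h2 (e.symm ⟨q, hq⟩)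
    refine ⟨p, p.2, ?_⟩
    rw [hcongr, hp, Quotient.out_eq]
    simp

/-- A map all of whose fibres are identified with `F` is a product projection. -/
theorem exists_equiv_prod_of_fibers {F : Type*} (c : V → W) (e : ∀ p, {v // c v = p} ≃ F) :
    ∃ E : V ≃ W × F, ∀ v, E v = (c v, e (c v) ⟨v, rfl⟩) :=
  ⟨(Equiv.sigmaFiberEquiv c).symm.trans
    ((Equiv.sigmaCongrRight e).trans (Equiv.sigmaEquivProd W F)), fun _ => rfl⟩

/-- If edges join only vertices with equal out-neighbourhoods, then vertices with equal
out-neighbourhoods also have equal in-neighbourhoods. -/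
theorem SetHomogeneous.in_congr [Finite V] {M : SDigraph V} (hM : M.IsS)
    (hsh : M.SetHomogeneous) (hedge : ∀ u v, M.edge u v → M.outSetoid u v)
    (u v w : V) (hvw : M.outSetoid v w) (huv : M.arc u v) : M.arc u w := by
  by_contra huw
  obtain ⟨hirr, hasym, heirr, hsymm, -⟩ := id hM
  set T : V → V → Prop := fun a b => ∃ b', M.outSetoid b' b ∧ M.arc a b' with hTdef
  have hTasym : ∀ a b, T a b → ¬ T b a := by
    rintro a b ⟨b', hb, hab⟩ ⟨a', ha, hba⟩
    exact hasym _ _ ((hb _).2 hba) ((ha _).2 hab)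
  have hTauto : ∀ g, M.IsAuto g → ∀ a b, T a b → T (g a) (g b) := by
    rintro g hg a b ⟨b', hb, hab⟩
    exact ⟨g b', (hg.outSetoid _ _).1 hb, (hg.1 _ _).1 hab⟩
  have harcT : ∀ a b, M.arc a b → T a b := fun a b h => ⟨b, M.outSetoid.refl b, h⟩
  have hTne : ∀ a b, T a b → ¬ M.outSetoid a b := by
    rintro a b ⟨b', hb, hab⟩ h
    exact hM.not_arc_of_outSetoid (M.outSetoid.trans h (M.outSetoid.symm hb)) hab
  have hTuw : T u w := ⟨v, hvw, huv⟩
  have hTtot : ∀ a b, ¬ M.outSetoid a b → T a b ∨ T b a := by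
    intro a b hab
    by_cases h1 : M.arc a b
    · exact .inl (harcT _ _ h1)
    by_cases h2 : M.arc b a
    · exact .inr (harcT _ _ h2)
    have hwu : ¬ M.arc w u := fun h => hasym _ _ huv ((hvw u).2 h)
    obtain ⟨g, hg, ⟨rfl, rfl⟩ | ⟨rfl, rfl⟩⟩ := hsh.exists_auto_pair hM (a := u) (b := w)
      (c := a) (d := b) (fun e => hTne _ _ hTuw (e ▸ M.outSetoid.refl _))
      (fun e => hab (e ▸ M.outSetoid.refl _)) (iff_of_false huw h1) (iff_of_false hwu h2)
      (iff_of_false (fun h => hTne _ _ hTuw (hedge _ _ h)) (fun h => hab (hedge _ _ h)))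
    · exact .inl (hTauto g hg _ _ hTuw)
    · exact .inr (hTauto g hg _ _ hTuw)
  have hpart : ∀ a b, T a b → ∃ b', M.outSetoid b' b ∧ ¬ M.arc a b' := by
    rintro a b ⟨b', hb, hab⟩
    obtain ⟨g, hg, rfl, rfl⟩ := hsh.exists_auto_arc hM huv hab
    exact ⟨g w, M.outSetoid.trans ((hg.outSetoid _ _).1 (M.outSetoid.symm hvw)) hb,
      fun h => huw ((hg.1 _ _).2 h)⟩
  obtain ⟨z, hzw, hzv⟩ : ∃ z, M.arc z w ∧ ¬ M.arc z v := by
    by_contra! hsub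
    have hss : {z | M.arc z w} ⊂ {z | M.arc z v} := ⟨hsub, fun h => huw (h huv)⟩
    obtain ⟨g, hg, rfl⟩ := hsh.transitive hM v w
    have him : g '' {z | M.arc z v} = {z | M.arc z (g v)} := by
      ext t
      rw [Equiv.image_eq_preimage_symm]
      simp [hg.1 _ v]
    have := Set.ncard_lt_ncard hss (Set.toFinite _)
    rw [← him, Set.ncard_image_of_injective _ g.injective] at this
    exact this.ne rfl
  -- two triples with a single arc, whose remaining vertex is placed differently by `T`
  have key : ∀ x z v w, T x z → M.outSetoid v w → M.arc x v → ¬ M.arc x w → M.arc z w →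
      ¬ M.arc z v → False := by
    intro x z₀ v w hxz₀ hvw hxv hxw hz₀w hz₀v
    obtain ⟨z, hz, hxz⟩ := hpart _ _ hxz₀
    have hTxz : T x z := by
      obtain ⟨z', hz', h⟩ := hxz₀
      exact ⟨z', M.outSetoid.trans hz' (M.outSetoid.symm hz), h⟩
    have hzw : M.arc z w := (hz w).2 hz₀w
    have hzv : ¬ M.arc z v := fun h => hz₀v ((hz v).1 h)
    have hzx : ¬ M.arc z x := fun h => hTasym _ _ hTxz (harcT _ _ h)
    have hwx : ¬ M.arc w x := fun h => hasym _ _ hxv ((hvw x).2 h)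
    have hvx : ¬ M.arc v x := hasym _ _ hxv
    have hvz : ¬ M.arc v z := fun h => hasym _ _ hzw ((hvw z).1 h)
    have hwz : ¬ M.arc w z := hasym _ _ hzw
    have nrel : ∀ {a b}, ¬ M.outSetoid a b →
        a ≠ b ∧ b ≠ a ∧ ¬ M.edge a b ∧ ¬ M.edge b a := fun {a b} h =>
      ⟨fun e => h (e ▸ M.outSetoid.refl _), fun e => h (e ▸ M.outSetoid.refl _),
        fun e => h (hedge _ _ e), fun e => h (M.outSetoid.symm (hedge _ _ e))⟩
    obtain ⟨a1, a2, a3, a4⟩ := nrel (hTne _ _ hTxz)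
    obtain ⟨b1, b2, b3, b4⟩ := nrel (hTne _ _ (harcT _ _ hxv))
    obtain ⟨c1, c2, c3, c4⟩ := nrel (hTne x w ⟨v, hvw, hxv⟩)
    obtain ⟨d1, d2, d3, d4⟩ := nrel (hTne _ _ (harcT _ _ hzw))
    obtain ⟨e1, e2, e3, e4⟩ := nrel (hTne z v ⟨w, M.outSetoid.symm hvw, hzw⟩)
    obtain ⟨g, hg, h1, -⟩ := hsh.exists_auto (f := ![x, z, v]) (f' := ![z, x, w])
      (by simp [Function.Injective, Fin.forall_fin_succ, *])
      (by simp [Function.Injective, Fin.forall_fin_succ, *])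
      (by simp [Fin.forall_fin_succ, *])
      (by simp [Fin.forall_fin_succ, *])
    simp only [Fin.forall_fin_succ, Fin.exists_fin_succ] at h1
    simp at h1
    obtain ⟨hx, hz, hv⟩ := h1
    have harc := (hg.1 _ _).1 hxv
    have hgxz := g.injective.ne a1
    have hgvz := g.injective.ne e1
    have hgx : g x = z ∧ g v = w := by
      rcases hx with h | h | h <;> rcases hv with h' | h' | h' <;> rw [h, h'] at harc <;>
        first | exact ⟨h, h'⟩ | exact absurd harc (by simp [*])
    have hgz : g z = x := by
      rcases hz with h | h | h
      · exact absurd (hgx.1.trans h.symm) hgxz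
      · exact h
      · exact absurd (h.trans hgx.2.symm) hgvz
    have := hTauto g hg _ _ hTxz
    rw [hgx.1, hgz] at this
    exact hTasym _ _ hTxz this
  have huz : ¬ M.outSetoid u z := fun h => hzv ((h v).1 huv)
  rcases hTtot u z huz with h | h
  · exact key u z v w h hvw huv huw hzw hzv
  · exact key z u w v h (M.outSetoid.symm hvw) hzw hzv huv huw

/-- The substructure on a class of an automorphism-invariant partition is set-homogeneous. -/
theorem SetHomogeneous.induce_class {M : SDigraph V} (hsh : M.SetHomogeneous)
    {C : Set V} (hC : ∀ g, M.IsAuto g → ∀ u ∈ C, g u ∈ C → ∀ v, v ∈ C ↔ g v ∈ C) :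
    (M.induce C).SetHomogeneous := by
  rintro U U' hU - ⟨e, he, he'⟩
  have := hU.to_subtype
  obtain ⟨g, hg, h1, h2⟩ := hsh.exists_auto (ι := U) (f := fun u => ((u : C) : V))
    (f' := fun u => ((e u : C) : V)) (fun _ _ h => Subtype.ext (Subtype.ext h))
    (fun _ _ h => e.injective (Subtype.ext (Subtype.ext h))) (fun u v => he u v)
    (fun u v => he' u v)
  rcases U.eq_empty_or_nonempty with rfl | ⟨u, hu⟩
  · refine ⟨Equiv.refl _, ⟨fun _ _ => Iff.rfl, fun _ _ => Iff.rfl⟩, ?_⟩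
    ext w
    simp only [Set.image_empty, Set.mem_empty_iff_false, false_iff]
    exact fun hw => (e.symm ⟨w, hw⟩).2
  have hgC := hC g hg u u.2 (by
    obtain ⟨v, hv⟩ := h1 ⟨u, hu⟩
    exact hv ▸ (e v).1.2)
  refine ⟨_, hg.induce hgC, ?_⟩
  ext w
  constructor
  · rintro ⟨u, hu, rfl⟩
    obtain ⟨v, hv⟩ := h1 ⟨u, hu⟩
    have : g.subtypeEquiv hgC u = e v := Subtype.ext hv
    rw [this]
    exact (e v).2
  · intro hw
    obtain ⟨u, hu⟩ := h2 (e.symm ⟨w, hw⟩)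
    exact ⟨u, u.2, Subtype.ext (by simpa using hu)⟩

theorem zmod_three_cases (i : ZMod 3) : i = 0 ∨ i = 1 ∨ i = 2 := by
  revert i
  decide

/-- A vertex-transitive tournament with an arc in which out-neighbours are unique is the
directed triangle. -/
theorem exists_triangle_labelling {A : SDigraph V} (hA : A.IsS)
    (hT : ∀ u v, u ≠ v → A.arc u v ∨ A.arc v u)
    (huniq : ∀ x y z, A.arc x y → A.arc x z → y = z) (hex : ∀ x, ∃ y, A.arc x y) (a : V) :
    ∃ c : V → ZMod 3, c.Bijective ∧ ∀ u v, A.arc u v ↔ c v = c u + 1 := by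
  classical
  obtain ⟨b, hab⟩ := hex a
  obtain ⟨d, hbd⟩ := hex b
  have hne : ∀ {u v}, A.arc u v → u ≠ v := fun h e => hA.1 _ (e ▸ h)
  have hda : A.arc d a := by
    have : d ≠ a := by rintro rfl; exact hA.2.1 _ _ hab hbd
    exact (hT d a this).resolve_right fun h => hne hbd (huniq a b d hab h)
  have hall : ∀ t, t = a ∨ t = b ∨ t = d := by
    intro t
    by_contra! h
    have h1 : A.arc t a := (hT t a h.1).resolve_right fun h' => h.2.1 (huniq _ _ _ h' hab)
    have h2 : A.arc t b := (hT t b h.2.1).resolve_right fun h' => h.2.2 (huniq _ _ _ h' hbd)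
    exact hne hab (huniq _ _ _ h1 h2)
  have hca : (fun t => if t = a then (0 : ZMod 3) else if t = b then 1 else 2) a = 0 := by simp
  have hcb : (fun t => if t = a then (0 : ZMod 3) else if t = b then 1 else 2) b = 1 := by
    simp [(hne hab).symm]
  have hcd : (fun t => if t = a then (0 : ZMod 3) else if t = b then 1 else 2) d = 2 := by
    simp [hne hda, (hne hbd).symm]
  generalize (fun t => if t = a then (0 : ZMod 3) else if t = b then 1 else 2) = c at hca hcb hcd
  have n1 : (0 : ZMod 3) ≠ 1 := by decide
  have n2 : (0 : ZMod 3) ≠ 2 := by decide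
  have n3 : (1 : ZMod 3) ≠ 2 := by decide
  refine ⟨c, ⟨fun u v huv => ?_, fun i => ?_⟩, fun u v => ?_⟩
  · rcases hall u with rfl | rfl | rfl <;> rcases hall v with rfl | rfl | rfl <;>
      simp_all
  · rcases zmod_three_cases i with rfl | rfl | rfl
    exacts [⟨a, hca⟩, ⟨b, hcb⟩, ⟨d, hcd⟩]
  · have := hA.2.1 _ _ hab
    have := hA.2.1 _ _ hbd
    have := hA.2.1 _ _ hda
    rcases hall u with rfl | rfl | rfl <;> rcases hall v with rfl | rfl | rfl <;>
      simp only [hA.1, *] <;> decide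

/-- The case where a pair joined by an edge has equal out-neighbourhoods. -/
theorem inListSameNbhd_of_edge {V : Type} [Finite V] {M : SDigraph V} (hM : M.IsS)
    (hsh : M.SetHomogeneous) {α β : V} (hαβ : M.edge α β) (hout : M.outSetoid α β) :
    InListSameNbhd M := by
  have hne : α ≠ β := fun e => hM.2.2.1 _ (e ▸ hαβ)
  have hedge : ∀ u v, M.edge u v → M.outSetoid u v := by
    intro u v huv
    have harc : ∀ {a b}, M.edge a b → ¬ M.arc a b ∧ ¬ M.arc b a := fun h =>
      ⟨hM.2.2.2.2 _ _ h, hM.2.2.2.2 _ _ (hM.2.2.2.1 _ _ h)⟩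
    obtain ⟨g, hg, ⟨rfl, rfl⟩ | ⟨rfl, rfl⟩⟩ := hsh.exists_auto_pair hM hne
      (fun e => hM.2.2.1 _ (e ▸ huv) : u ≠ v) (iff_of_false (harc hαβ).1 (harc huv).1)
      (iff_of_false (harc hαβ).2 (harc huv).2) (iff_of_true hαβ huv)
    · exact (hg.outSetoid _ _).1 hout
    · exact (hg.outSetoid _ _).1 (M.outSetoid.symm hout)
  have hin := hsh.in_congr hM hedge
  have hQS := outQuotient_isS hM
  have hQ := outQuotient_setHomogeneous hM hsh hin hedge
  have hQarc := outQuotient_arc hin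
  have hfib : ∀ u v, ∃ g : V ≃ V, M.IsAuto g ∧
      ∀ w, (⟦w⟧ : Quotient M.outSetoid) = ⟦u⟧ ↔ (⟦g w⟧ : Quotient M.outSetoid) = ⟦v⟧ := by
    intro u v
    obtain ⟨g, hg, rfl⟩ := hsh.transitive hM u v
    refine ⟨g, hg, fun w => ?_⟩
    rw [Quotient.eq, Quotient.eq]
    exact hg.outSetoid w u
  by_cases hcase : ∀ u v, u ≠ v → M.outSetoid u v → M.edge u v
  · refine .inr ⟨Nat.card {v : V // (⟦v⟧ : Quotient M.outSetoid) = ⟦α⟧}, ?_, _,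
      Fintype.ofFinite _, _, hQS, fun _ _ => id, hQ, ?_⟩
    · rw [Finite.one_lt_card_iff_nontrivial]
      exact ⟨⟨α, rfl⟩, ⟨β, Quotient.sound (M.outSetoid.symm hout)⟩,
        fun e => hne (congrArg Subtype.val e)⟩
    have he : ∀ p : Quotient M.outSetoid, Nonempty ({v : V // (⟦v⟧ : Quotient M.outSetoid) = p} ≃
        Fin (Nat.card {v : V // (⟦v⟧ : Quotient M.outSetoid) = ⟦α⟧})) := by
      rintro ⟨u⟩
      obtain ⟨g, -, hg⟩ := hfib u α
      exact ⟨(g.subtypeEquiv hg).trans (Finite.equivFin _)⟩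
    obtain ⟨E, hE⟩ := exists_equiv_prod_of_fibers
      (fun v => (⟦v⟧ : Quotient M.outSetoid)) fun p => (he p).some
    have hE1 : ∀ v, (E v).1 = ⟦v⟧ := fun v => by rw [hE]
    refine ⟨E, fun u v => ?_, fun u v => ?_⟩
    · simp [comp, K, hE1, hQarc]
    · simp only [comp, K, hE1, outQuotient, false_or, Quotient.eq]
      refine ⟨fun h => ⟨hedge _ _ h, fun e => ?_⟩, fun h => hcase u v ?_ h.1⟩
      · have : u = v := E.injective (Prod.ext
          (by rw [hE1, hE1]; exact Quotient.sound (hedge _ _ h)) e)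
        exact hM.2.2.1 _ (this ▸ h)
      · rintro rfl
        exact h.2 rfl
  · push Not at hcase
    obtain ⟨u₀, v₀, hne₀, hout₀, hedge₀⟩ := hcase
    have hnarc : ∀ {a b}, M.outSetoid a b → ¬ M.arc a b ∧ ¬ M.arc b a := fun h =>
      ⟨hM.not_arc_of_outSetoid h, hM.not_arc_of_outSetoid (M.outSetoid.symm h)⟩
    have htot : ∀ u v, M.outSetoid u v ∨ M.arc u v ∨ M.arc v u := by
      intro u v
      by_contra! h
      obtain ⟨h, h1, h2⟩ := h
      obtain ⟨g, hg, ⟨rfl, rfl⟩ | ⟨rfl, rfl⟩⟩ := hsh.exists_auto_pair hM hne₀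
        (fun e => h (e ▸ M.outSetoid.refl _) : u ≠ v) (iff_of_false (hnarc hout₀).1 h1)
        (iff_of_false (hnarc hout₀).2 h2) (iff_of_false hedge₀ fun h' => h (hedge _ _ h'))
      · exact h ((hg.outSetoid _ _).1 hout₀)
      · exact h ((hg.outSetoid _ _).1 (M.outSetoid.symm hout₀))
    by_cases harcs : M.NoArcs
    · exact .inl ⟨V, Fintype.ofFinite V, M, hM, harcs, hsh, .inl
        ⟨Equiv.refl V, fun _ _ => Iff.rfl, fun _ _ => Iff.rfl⟩⟩
    simp only [NoArcs, not_forall, not_not] at harcs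
    obtain ⟨a, b, hab⟩ := harcs
    have hT : ∀ p q, p ≠ q → M.outQuotient.arc p q ∨ M.outQuotient.arc q p := by
      rintro ⟨u⟩ ⟨v⟩ huv
      exact ((htot u v).resolve_left fun h => huv (Quotient.sound h)).imp
        (hQarc u v).2 (hQarc v u).2
    obtain ⟨c, hc, hcarc⟩ := exists_triangle_labelling hQS hT
      (hQ.out_unique hQS (fun _ _ => id) hT) (by
        rintro ⟨u⟩
        obtain ⟨g, hg, rfl⟩ := hsh.transitive hM a u
        exact ⟨⟦g b⟧, (hQarc _ _).2 ((hg.1 _ _).1 hab)⟩) ⟦a⟧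
    have hc_iff : ∀ u v : V, c ⟦u⟧ = c ⟦v⟧ ↔ M.outSetoid u v := fun u v =>
      hc.1.eq_iff.trans Quotient.eq
    have he : ∀ i, ∃ g : V ≃ V, M.IsAuto g ∧ ∀ v, c ⟦v⟧ = i ↔ g v ∈ {v | c ⟦v⟧ = 0} := by
      intro i
      obtain ⟨⟨u⟩, rfl⟩ := hc.2 i
      obtain ⟨⟨v⟩, hv⟩ := hc.2 0
      obtain ⟨g, hg, h⟩ := hfib u v
      refine ⟨g, hg, fun w => ?_⟩
      rw [Set.mem_ofPred_eq, ← hv]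
      exact hc.1.eq_iff.trans ((h w).trans hc.1.eq_iff.symm)
    choose g hg hgc using he
    obtain ⟨E, hE⟩ := exists_equiv_prod_of_fibers (fun v : V => c ⟦v⟧) fun i =>
      (g i).subtypeEquiv (hgc i)
    refine .inl ⟨_, Fintype.ofFinite _, M.induce {v | c ⟦v⟧ = 0}, hM.induce _, ?_, ?_,
      .inr ⟨E, ?_, ?_⟩⟩
    · intro u v h
      exact (hnarc ((hc_iff u v).1 (u.2.trans v.2.symm))).1 h
    · refine hsh.induce_class fun f hf u hu hfu v => ?_
      rw [Set.mem_ofPred_eq] at hu hfu ⊢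
      rw [Set.mem_ofPred_eq, ← hu, hc_iff, hu, ← hfu, hc_iff]
      exact hf.outSetoid v u
    · intro u v
      rw [hE, hE]
      simp only [comp, D3, ← hcarc, hQarc]
      refine ⟨.inl, ?_⟩
      rintro (h | ⟨h, h'⟩)
      · exact h
      · change M.arc (g (c ⟦u⟧) u) (g (c ⟦v⟧) v) at h'
        rw [← h] at h'
        exact ((hg _).1 u v).2 h'
    · intro u v
      rw [hE, hE]
      simp only [comp, D3, false_or]
      refine ⟨fun h => ?_, ?_⟩
      · have huv := (hc_iff u v).2 (hedge _ _ h)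
        refine ⟨huv, ?_⟩
        have := ((hg (c ⟦u⟧)).2 u v).1 h
        simpa [induce, ← huv] using this
      · rintro ⟨h, h'⟩
        refine ((hg (c ⟦u⟧)).2 u v).2 ?_
        simpa [induce, ← h] using h'

/-- The s-digraph with all arcs reversed. -/
def reverse (M : SDigraph V) : SDigraph V :=
  ⟨fun u v => M.arc v u, M.edge⟩

theorem IsS.reverse {M : SDigraph V} (hM : M.IsS) : M.reverse.IsS :=
  ⟨hM.1, fun u v => hM.2.1 v u, hM.2.2.1, hM.2.2.2.1,
    fun u v h => hM.2.2.2.2 v u (hM.2.2.2.1 _ _ h)⟩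

theorem SetHomogeneous.reverse {M : SDigraph V} (hsh : M.SetHomogeneous) :
    M.reverse.SetHomogeneous := by
  rintro U U' hU hU' ⟨e, he, he'⟩
  obtain ⟨g, hg, hgU⟩ := hsh U U' hU hU' ⟨e, fun u v => he v u, he'⟩
  exact ⟨g, ⟨fun u v => hg.1 v u, hg.2⟩, hgU⟩

theorem IsS.compl {M : SDigraph V} (hM : M.IsS) : M.compl.IsS :=
  ⟨hM.1, fun u v => hM.2.1 v u, fun _ h => h.1 rfl,
    fun _ _ h => ⟨h.1.symm, fun h' => h.2.1 (hM.2.2.2.1 _ _ h'), h.2.2.2, h.2.2.1⟩,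
    fun _ _ h => h.2.2.2⟩

theorem IsS.edge_iff_compl {M : SDigraph V} (hM : M.IsS) (u v : V) :
    M.edge u v ↔ u ≠ v ∧ ¬ M.compl.edge u v ∧ ¬ M.arc u v ∧ ¬ M.arc v u := by
  have h1 : M.edge u v → u ≠ v := fun h e => hM.2.2.1 _ (e ▸ h)
  have h2 := hM.2.2.2.2 u v
  have h3 : M.edge u v → ¬ M.arc v u := fun h => hM.2.2.2.2 v u (hM.2.2.2.1 _ _ h)
  simp only [SDigraph.compl]
  tauto

theorem SetHomogeneous.compl {M : SDigraph V} (hM : M.IsS) (hsh : M.SetHomogeneous) :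
    M.compl.SetHomogeneous := by
  rintro U U' hU hU' ⟨e, he, he'⟩
  have he : ∀ u v : U, M.arc u v ↔ M.arc (e u) (e v) := fun u v => he v u
  have he' : ∀ u v : U, M.compl.edge u v ↔ M.compl.edge (e u) (e v) := he'
  have hne : ∀ u v : U, (u : V) ≠ v ↔ (e u : V) ≠ e v := fun u v => by
    simp [Subtype.ext_iff.symm]
  obtain ⟨g, hg, hgU⟩ := hsh U U' hU hU' ⟨e, he, fun u v => by
    change M.edge _ _ ↔ M.edge _ _
    rw [hM.edge_iff_compl, hM.edge_iff_compl (e u : V), he, he, he', hne]⟩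
  refine ⟨g, ⟨fun u v => hg.1 v u, fun u v => ?_⟩, hgU⟩
  simp only [SDigraph.compl, ← hg.1, ← hg.2, g.injective.ne_iff]

theorem inListSameNbhd_of_reverse {V : Type} {M : SDigraph V}
    (h : InListSameNbhd M.reverse) : InListSameNbhd M := by
  rcases h with ⟨T, hT, L, hL, harcs, hsh, ⟨e, he, he'⟩ | ⟨e, he, he'⟩⟩ |
    ⟨n, hn, T, hT, A, hA, hE, hsh, e, he, he'⟩
  · exact .inl ⟨T, hT, L, hL, harcs, hsh, .inl ⟨e, fun u v => (he v u).trans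
      (iff_of_false (harcs _ _) (harcs _ _)), he'⟩⟩
  · refine .inl ⟨T, hT, L, hL, harcs, hsh, .inr
      ⟨e.trans ((Equiv.neg (ZMod 3)).prodCongr (Equiv.refl T)), fun u v => (he v u).trans ?_,
        fun u v => (he' u v).trans ?_⟩⟩
    · have : ∀ i j : ZMod 3, j = i + 1 ↔ -i = -j + 1 := by decide
      have harcs : ∀ u v, ¬ L.arc u v := harcs
      simp only [comp, D3, harcs, and_false, or_false]
      exact this _ _
    · simp [comp, D3]
  · refine .inr ⟨n, hn, T, hT, A.reverse, hA.reverse, hE, hsh.reverse, e,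
      fun u v => (he v u).trans ?_, fun u v => (he' u v).trans Iff.rfl⟩
    simp [comp, K, SDigraph.reverse]

end SDigraph

/-- A finite Γ-connected set-homogeneous s-digraph with two
distinct vertices having the same out-neighbourhood is, up to
complementation, isomorphic to a finite set-homogeneous graph `L`, to
`D₃[L]`, or to `A[K_n]` with `n > 1`. -/
theorem finite_set_homogeneous_sdigraph_same_out_nbhd
    {V : Type} [Fintype V] (M : SDigraph V) (hM : M.IsS)
    (hsh : M.SetHomogeneous) (hconn : M.GammaConnected)
    (α β : V) (hne : α ≠ β)
    (hΓ : {x | M.arc α x} = {x | M.arc β x}) :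
    InListSameNbhd M ∨ InListSameNbhd M.compl := by
  have hout : M.outSetoid α β := fun x => Set.ext_iff.1 hΓ x
  by_cases hαβ : M.edge α β
  · exact .inl (inListSameNbhd_of_edge hM hsh hαβ hout)
  · refine .inr (inListSameNbhd_of_reverse (inListSameNbhd_of_edge hM.compl.reverse
      (hsh.compl hM).reverse (α := α) (β := β) ?_ hout))
    exact ⟨hne, hαβ, hM.not_arc_of_outSetoid hout,
      hM.not_arc_of_outSetoid (M.outSetoid.symm hout)⟩
end

section
/- Let M be a finite set-homogeneous a-digraph and let α be a vertex of M such that the subdigraphs induced on Γ(α) and on Γ*(α) are isomorphic. Then M is isomorphic to one of: D_1, D_3, D_4, D_5, H_0, K̄_n, K̄_n[D_3], or D_3[K̄_n], for some integer n ≥ 1. -/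
open ADigraph

namespace ADigraph

section SetHomogeneous

variable {V W : Type*} {M : ADigraph V}

theorem Iso.symm {N : ADigraph W} (h : M.Iso N) : N.Iso M := by
  obtain ⟨e, he⟩ := h
  exact ⟨e.symm, fun u v => by simp [he]⟩

theorem iso_of_bijective {N : ADigraph W} (e : W → V) (hb : Function.Bijective e)
    (he : ∀ u v, N.arc u v ↔ M.arc (e u) (e v)) : M.Iso N :=
  Iso.symm ⟨Equiv.ofBijective e hb, he⟩

theorem IsA.ne (hM : M.IsA) {a b : V} (h : M.arc a b) : a ≠ b := by
  rintro rfl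
  exact hM.1 _ h

theorem IsAuto.symm {g : V ≃ V} (h : M.IsAuto g) : M.IsAuto g.symm := fun u v => by
  rw [h (g.symm u)]; simp

theorem IsAuto.trans {g h : V ≃ V} (hg : M.IsAuto g) (hh : M.IsAuto h) :
    M.IsAuto (g.trans h) := fun u v => by
  rw [hg, hh]; rfl

variable [Finite V]

theorem SetHomogeneous.exists_image_eq (hsh : M.SetHomogeneous) (U : Set V) (φ : V → V)
    (hi : Set.InjOn φ U) (ha : ∀ u ∈ U, ∀ v ∈ U, M.arc u v ↔ M.arc (φ u) (φ v)) :
    ∃ g : V ≃ V, M.IsAuto g ∧ ⇑g '' U = φ '' U :=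
  hsh U (φ '' U) U.toFinite (Set.toFinite _)
    ⟨Set.BijOn.equiv φ hi.bijOn_image, fun u v => ha u u.2 v v.2⟩

theorem SetHomogeneous.exists_apply_eq (hM : M.IsA) (hsh : M.SetHomogeneous) (x y : V) :
    ∃ g : V ≃ V, M.IsAuto g ∧ g x = y := by
  obtain ⟨g, hg, h⟩ := hsh.exists_image_eq {x} (fun _ => y) (by simp) (by simp [hM.1])
  exact ⟨g, hg, by simpa using h⟩

theorem SetHomogeneous.exists_image_pair (hM : M.IsA) (hsh : M.SetHomogeneous) {a b c d : V}
    (hab : a ≠ b) (hcd : c ≠ d) (h₁ : M.arc a b ↔ M.arc c d) (h₂ : M.arc b a ↔ M.arc d c) :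
    ∃ g : V ≃ V, M.IsAuto g ∧ (g a = c ∧ g b = d ∨ g a = d ∧ g b = c) := by
  classical
  obtain ⟨g, hg, h⟩ := hsh.exists_image_eq {a, b} (fun z => if z = a then c else d)
    (by intro u hu v hv; simp at hu hv ⊢; grind)
    (by have := hM.1; simp [hab.symm, h₁, h₂, this])
  refine ⟨g, hg, ?_⟩
  have hne : g a ≠ g b := g.injective.ne hab
  rw [Set.image_pair, Set.image_pair] at h
  have ha : g a ∈ ({g a, g b} : Set V) := by simp
  have hb : g b ∈ ({g a, g b} : Set V) := by simp
  rw [h] at ha hb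
  simp [hab.symm] at ha hb
  grind

theorem SetHomogeneous.exists_apply_arc (hM : M.IsA) (hsh : M.SetHomogeneous) {a b c d : V}
    (hab : M.arc a b) (hcd : M.arc c d) :
    ∃ g : V ≃ V, M.IsAuto g ∧ g a = c ∧ g b = d := by
  obtain ⟨g, hg, h | ⟨h, h'⟩⟩ := hsh.exists_image_pair hM (hM.ne hab) (hM.ne hcd)
    (by simp [hab, hcd]) (by simp [hM.2 _ _ hab, hM.2 _ _ hcd])
  · exact ⟨g, hg, h⟩
  · have := (hg a b).1 hab
    rw [h, h'] at this
    exact absurd this (hM.2 _ _ hcd)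

/-- Induced subdigraphs of an out-neighbourhood that are isomorphic are related by an automorphism
fixing the dominating vertex. -/
theorem SetHomogeneous.exists_image_eq_of_dominated (hM : M.IsA) (hsh : M.SetHomogeneous) (α : V)
    (S : Set V) (φ : V → V) (hS : ∀ u ∈ S, M.arc α u) (hφ : ∀ u ∈ S, M.arc α (φ u))
    (hi : Set.InjOn φ S) (ha : ∀ u ∈ S, ∀ v ∈ S, M.arc u v ↔ M.arc (φ u) (φ v)) :
    ∃ g : V ≃ V, M.IsAuto g ∧ g α = α ∧ ⇑g '' S = φ '' S := by
  classical
  have hα : α ∉ S := fun h => hM.1 _ (hS _ h)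
  have hne : ∀ u ∈ S, u ≠ α := fun u hu h => hα (h ▸ hu)
  have him : (fun z => if z = α then α else φ z) '' insert α S = insert α (φ '' S) := by
    rw [Set.image_insert_eq]
    simp only [if_true]
    congr 1
    exact Set.image_congr fun u hu => by simp [hne u hu]
  obtain ⟨g, hg, h⟩ := hsh.exists_image_eq (insert α S) (fun z => if z = α then α else φ z)
    (by
      rintro u (rfl | hu) v (rfl | hv) huv
      · rfl
      · simp [hne v hv] at huv
        exact absurd (huv ▸ hφ v hv) (hM.1 _)
      · simp [hne u hu] at huv
        exact absurd (huv ▸ hφ u hu) (hM.1 _)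
      · simp [hne u hu, hne v hv] at huv
        exact hi hu hv huv)
    (by
      rintro u (rfl | hu) v (rfl | hv)
      · simp
      · simp [hne v hv, hS v hv, hφ v hv]
      · simp [hne u hu, hM.2 _ _ (hS u hu), hM.2 _ _ (hφ u hu)]
      · simp [hne u hu, hne v hv, ha u hu v hv])
  rw [him] at h
  have hgα : g α = α := by
    by_contra hgα
    have h₁ : g α ∈ insert α (φ '' S) := h ▸ Set.mem_image_of_mem g (Set.mem_insert _ _)
    obtain h₁ | ⟨u, hu, h₁⟩ := h₁
    · exact hgα h₁
    have h₂ : α ∈ ⇑g '' insert α S := h ▸ Set.mem_insert _ _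
    obtain ⟨s, rfl | hs, h₂⟩ := h₂
    · exact hgα h₂
    have h₃ := (hg _ _).1 (hS s hs)
    rw [h₂, ← h₁] at h₃
    exact hM.2 _ _ h₃ (hφ u hu)
  refine ⟨g, hg, hgα, ?_⟩
  rw [Set.image_insert_eq, hgα] at h
  have hα₁ : α ∉ ⇑g '' S := by
    rintro ⟨s, hs, h₁⟩
    exact hα (g.injective (h₁.trans hgα.symm) ▸ hs)
  have hα₂ : α ∉ φ '' S := by
    rintro ⟨s, hs, h₁⟩
    exact hM.1 _ (h₁ ▸ hφ s hs)
  rw [← Set.insert_sdiff_self_of_notMem hα₁, h, Set.insert_sdiff_self_of_notMem hα₂]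

/-- Out-neighbourhoods are carried to in-neighbourhoods by automorphisms. -/
theorem SetHomogeneous.exists_inNbhd_eq_outNbhd (hM : M.IsA) (hsh : M.SetHomogeneous) (α : V)
    (hiso : (M.induce {x | M.arc α x}).Iso (M.induce {x | M.arc x α})) (x y : V) :
    ∃ g : V ≃ V, M.IsAuto g ∧ ∀ z, M.arc x z ↔ M.arc (g z) y := by
  obtain ⟨g, hg, h⟩ := hsh _ _ (Set.toFinite _) (Set.toFinite _) hiso
  obtain ⟨a, ha, hax⟩ := hsh.exists_apply_eq hM x α
  obtain ⟨b, hb, hby⟩ := hsh.exists_apply_eq hM α y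
  refine ⟨(a.trans g).trans b, (ha.trans hg).trans hb, fun z => ?_⟩
  have h₁ : ∀ w, M.arc α w ↔ M.arc (g w) α := fun w => by
    have : g w ∈ ⇑g '' {x | M.arc α x} ↔ g w ∈ {x | M.arc x α} := by rw [h]
    simpa using this
  rw [ha, hax, h₁, hb, hby]
  rfl

end SetHomogeneous

section Reciprocal

variable {V : Type*} [Finite V] {M : ADigraph V}

/-- In a set-homogeneous a-digraph with isomorphic out- and in-neighbourhoods, if the
out-neighbourhoods are tournaments then they have one vertex or are directed triangles. -/
theorem outNbhd_eq_of_tournament (hM : M.IsA) (hsh : M.SetHomogeneous)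
    (hio : ∀ x y, ∃ g : V ≃ V, M.IsAuto g ∧ ∀ z, M.arc x z ↔ M.arc (g z) y)
    {α β : V} (hαβ : M.arc α β)
    (ht : ∀ x y, M.arc α x → M.arc α y → x ≠ y → M.arc x y ∨ M.arc y x) :
    (∀ z, M.arc α z ↔ z = β) ∨ ∃ b c, M.arc β b ∧ M.arc b c ∧ M.arc c β ∧
      ∀ z, M.arc α z ↔ z = β ∨ z = b ∨ z = c := by
  obtain ⟨φ, hφ, hφα⟩ := hio α β
  obtain ⟨h, hh, hh₁, hh₂⟩ := hsh.exists_apply_arc hM ((hφα β).1 hαβ) hαβ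
  have hk : M.IsAuto (φ.trans h).symm := (hφ.trans hh).symm
  have hkz : ∀ z, M.arc α z ∧ M.arc β z ↔
      M.arc α ((φ.trans h) z) ∧ M.arc ((φ.trans h) z) β := fun z => by
    rw [hφα, hφ β z, hh (φ z), hh (φ β), hh₁, hh₂]
    simp [and_comm]
  have hkz' : ∀ z, M.arc α z ∧ M.arc z β ↔
      M.arc α ((φ.trans h).symm z) ∧ M.arc β ((φ.trans h).symm z) := fun z => by
    rw [hkz]; simp
  obtain ⟨g, hg, hgα, hgS⟩ := hsh.exists_image_eq_of_dominated hM α {z | M.arc α z ∧ M.arc z β}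
    (φ.trans h).symm (fun u hu => hu.1) (fun u hu => ((hkz' u).1 hu).1)
    (Equiv.injective _).injOn (fun u _ v _ => hk u v)
  have hgz : ∀ z, M.arc α z ∧ M.arc z β ↔ M.arc α (g z) ∧ M.arc β (g z) := fun z => by
    have h₁ : g z ∈ ⇑g '' {z | M.arc α z ∧ M.arc z β} ↔
      g z ∈ ⇑(φ.trans h).symm '' {z | M.arc α z ∧ M.arc z β} := by rw [hgS]
    rw [Equiv.image_symm_eq_preimage, g.injective.mem_set_image] at h₁
    simp only [Set.mem_ofPred_eq, Set.mem_preimage] at h₁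
    rw [h₁, hkz (g z)]
  have hgβ : M.arc α (g β) := by
    have := (hg _ _).1 hαβ
    rwa [hgα] at this
  have hζ : ∀ z, M.arc α z → (M.arc β z ↔ M.arc z (g β)) := fun z hz => by
    have h₁ := hgz (g.symm z)
    have h₂ := hg α (g.symm z)
    have h₃ := hg (g.symm z) β
    simp only [hgα, Equiv.apply_symm_apply] at h₁ h₂ h₃
    tauto
  by_cases hβ : g β = β
  · left
    rw [hβ] at hζ
    refine fun z => ⟨fun hz => ?_, fun hz => hz ▸ hαβ⟩
    by_contra hne
    have := hM.2 z β
    have := ht z β hz hαβ hne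
    have := hζ z hz
    tauto
  right
  have hcβ : M.arc (g β) β := by
    rcases ht _ _ hgβ hαβ hβ with h₁ | h₁
    · exact h₁
    · exact absurd ((hζ _ hgβ).1 h₁) (hM.1 _)
  have harc : ∀ x y, M.arc α x → M.arc α y → M.arc x y →
      ∀ z, M.arc α z → (M.arc y z ↔ M.arc z x) := by
    classical
    intro x y hx hy hxy z hz
    obtain ⟨k, hk, hkα, hkS⟩ := hsh.exists_image_eq_of_dominated hM α {x, y}
      (fun w => if w = x then g β else β)
      (by simp [hx, hy]) (by simp [(hM.ne hxy).symm, hgβ, hαβ])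
      (by
        intro u hu v hv
        simp at hu hv ⊢
        grind)
      (by simp [(hM.ne hxy).symm, hM.1, hxy, hcβ, hM.2 _ _ hxy, hM.2 _ _ hcβ])
    have hne : k x ≠ k y := k.injective.ne (hM.ne hxy)
    rw [Set.image_pair, Set.image_pair] at hkS
    have ha : k x ∈ ({k x, k y} : Set V) := by simp
    have hb : k y ∈ ({k x, k y} : Set V) := by simp
    rw [hkS] at ha hb
    simp [(hM.ne hxy).symm] at ha hb
    have hkxy := (hk _ _).1 hxy
    have := hM.2 _ _ hcβ
    have hkx : k x = g β ∧ k y = β := by grind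
    rw [hk, hkx.2, hk z, hkx.1]
    refine hζ _ ?_
    have := (hk _ _).1 hz
    rwa [hkα] at this
  obtain ⟨hαb, hβb⟩ := (hgz (g β)).1 ⟨hgβ, hcβ⟩
  refine ⟨g (g β), g β, hβb, (hζ _ hαb).1 hβb, hcβ, fun z => ⟨fun hz => ?_, ?_⟩⟩
  · have huniq : ∀ u v, M.arc α u → M.arc β u → M.arc α v → M.arc β v → u = v := by
      intro u v hu hu' hv hv'
      by_contra hne
      rcases ht u v hu hv hne with h₁ | h₁
      · exact hM.2 _ _ hv' ((harc u v hu hv h₁ β hαβ).2 hu')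
      · exact hM.2 _ _ hu' ((harc v u hv hu h₁ β hαβ).2 hv')
    by_cases hne : z = β
    · exact Or.inl hne
    rcases ht z β hz hαβ hne with h₁ | h₁
    · obtain ⟨h₂, h₃⟩ := (hgz z).1 ⟨hz, h₁⟩
      exact Or.inr (Or.inr (g.injective (huniq _ _ h₂ h₃ hαb hβb)))
    · exact Or.inr (Or.inl (huniq _ _ hz h₁ hαb hβb))
  · rintro (rfl | rfl | rfl)
    exacts [hαβ, hαb, hgβ]

end Reciprocal

section Recognition

variable {V : Type*} {M : ADigraph V}

theorem iso_kbar_card [Fintype V] (h : ∀ x y, ¬ M.arc x y) : M.Iso (kbar (Fintype.card V)) :=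
  ⟨Fintype.equivFin V, fun u v => by simp [kbar, h]⟩

theorem iso_dirCycle_of_bijective {n : ℕ} (hn : 1 < n) {f : V → V}
    (hf : ∀ x z, M.arc x z ↔ z = f x) (e : ZMod n → V) (he : Function.Bijective e)
    (hef : ∀ i, e (i + 1) = f (e i)) : M.Iso (dirCycle n) := by
  have : Fact (1 < n) := ⟨hn⟩
  refine iso_of_bijective e he fun i j => ?_
  rw [hf, ← hef, he.1.eq_iff]
  refine ⟨fun h => h.1, fun h => ⟨h, ?_⟩⟩
  rw [h]
  simp

theorem iso_dirCycle_four {f : V → V} (hf : ∀ x z, M.arc x z ↔ z = f x) (x : V)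
    (h₁ : f x ≠ x) (h₂ : f (f x) ≠ x) (h₃ : f (f (f x)) ≠ x) (h₄ : f (f (f (f x))) = x)
    (hinj : Function.Injective f)
    (hV : ∀ y, y = x ∨ y = f x ∨ y = f (f x) ∨ y = f (f (f x))) : M.Iso (dirCycle 4) := by
  have e₁ := hinj.eq_iff (a := f x) (b := x)
  have e₂ := hinj.eq_iff (a := f (f x)) (b := x)
  have e₃ := hinj.eq_iff (a := f (f x)) (b := f x)
  refine iso_dirCycle_of_bijective (by norm_num) hf
    (![x, f x, f (f x), f (f (f x))] : Fin 4 → V) ⟨?_, ?_⟩ ?_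
  · intro i j hij
    change Fin 4 at i j
    fin_cases i <;> fin_cases j <;> simp at hij ⊢ <;> grind
  · intro y
    rcases hV y with rfl | rfl | rfl | rfl
    exacts [⟨(0 : Fin 4), rfl⟩, ⟨(1 : Fin 4), rfl⟩, ⟨(2 : Fin 4), rfl⟩, ⟨(3 : Fin 4), rfl⟩]
  · intro i
    change Fin 4 at i
    fin_cases i
    exacts [rfl, rfl, rfl, h₄.symm]

theorem iso_dirCycle_five {f : V → V} (hf : ∀ x z, M.arc x z ↔ z = f x) (x : V)
    (h₁ : f x ≠ x) (h₂ : f (f x) ≠ x) (h₃ : f (f (f x)) ≠ x) (h₄ : f (f (f (f x))) ≠ x)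
    (h₅ : f (f (f (f (f x)))) = x) (hinj : Function.Injective f)
    (hV : ∀ y, y = x ∨ y = f x ∨ y = f (f x) ∨ y = f (f (f x)) ∨ y = f (f (f (f x)))) :
    M.Iso (dirCycle 5) := by
  have e₁ := hinj.eq_iff (a := f x) (b := x)
  have e₂ := hinj.eq_iff (a := f (f x)) (b := x)
  have e₃ := hinj.eq_iff (a := f (f x)) (b := f x)
  have e₄ := hinj.eq_iff (a := f (f (f x))) (b := x)
  have e₅ := hinj.eq_iff (a := f (f (f x))) (b := f x)
  have e₆ := hinj.eq_iff (a := f (f (f x))) (b := f (f x))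
  refine iso_dirCycle_of_bijective (by norm_num) hf
    (![x, f x, f (f x), f (f (f x)), f (f (f (f x)))] : Fin 5 → V) ⟨?_, ?_⟩ ?_
  · intro i j hij
    change Fin 5 at i j
    fin_cases i <;> fin_cases j <;> simp at hij ⊢ <;> grind
  · intro y
    rcases hV y with rfl | rfl | rfl | rfl | rfl
    exacts [⟨(0 : Fin 5), rfl⟩, ⟨(1 : Fin 5), rfl⟩, ⟨(2 : Fin 5), rfl⟩, ⟨(3 : Fin 5), rfl⟩,
      ⟨(4 : Fin 5), rfl⟩]
  · intro i
    change Fin 5 at i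
    fin_cases i
    exacts [rfl, rfl, rfl, rfl, h₅.symm]

/-- A fixed-point-free map of order three is a disjoint union of directed triangles. -/
theorem iso_kbar_comp_dirCycle_three [Finite V] [Nonempty V] {f : V → V}
    (hf : ∀ x z, M.arc x z ↔ z = f x) (h₁ : ∀ x, f x ≠ x) (h₃ : ∀ x, f (f (f x)) = x) :
    ∃ n : ℕ, 1 ≤ n ∧ M.Iso ((kbar n).comp (dirCycle 3)) := by
  let s : Setoid V :=
    { r := fun x y => y = x ∨ y = f x ∨ y = f (f x)
      iseqv := ⟨fun x => Or.inl rfl, fun {x y} h => by grind, fun {x y z} h h' => by grind⟩ }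
  have hs : ∀ x y, s x y ↔ y = x ∨ y = f x ∨ y = f (f x) := fun _ _ => Iff.rfl
  have : Nonempty (Quotient s) := Nonempty.map (Quotient.mk s) inferInstance
  refine ⟨Nat.card (Quotient s), Nat.card_pos, ?_⟩
  let q := (Finite.equivFin (Quotient s)).symm
  let r : V → Fin 3 → V := fun x => ![x, f x, f (f x)]
  have hr : ∀ x i, Quotient.mk s (r x i) = Quotient.mk s x := fun x i => by
    refine (Quotient.sound ?_).symm
    change s _ _
    rw [hs]
    fin_cases i <;> simp [r]
  have hrf : ∀ x (i : Fin 3), r x (i + 1) = f (r x i) := fun x i => by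
    fin_cases i
    exacts [rfl, rfl, (h₃ x).symm]
  have hri : ∀ x, Function.Injective (r x) := fun x i j hij => by
    have h := h₁ x
    have h' := h₁ (f x)
    have h'' := h₁ (f (f x))
    rw [h₃] at h''
    fin_cases i <;> fin_cases j <;> simp [r] at hij ⊢ <;> grind
  have hinj : ∀ (a b : Fin (Nat.card (Quotient s))) (i j : Fin 3),
      r (q a).out i = r (q b).out j ↔ a = b ∧ i = j := by
    refine fun a b i j => ⟨fun h => ?_, by rintro ⟨rfl, rfl⟩; rfl⟩
    have h' := congrArg (Quotient.mk s) h
    rw [hr, hr, Quotient.out_eq, Quotient.out_eq, q.injective.eq_iff] at h'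
    subst h'
    exact ⟨rfl, hri _ h⟩
  have harc : ∀ (a b : Fin (Nat.card (Quotient s))) (i j : Fin 3),
      r (q b).out j = f (r (q a).out i) ↔ b = a ∧ j = i + 1 := fun a b i j => by
    rw [← hrf, hinj]
  refine iso_of_bijective (fun p : _ × Fin 3 => r (q p.1).out p.2) ⟨?_, ?_⟩ ?_
  · rintro ⟨a, i⟩ ⟨b, j⟩ h
    rw [Prod.mk.injEq]
    exact (hinj _ _ _ _).1 h
  · intro y
    have h : s (Quotient.mk s y).out y := Quotient.exact (Quotient.out_eq _)
    rw [hs] at h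
    have hq : q (q.symm (Quotient.mk s y)) = Quotient.mk s y := q.apply_symm_apply _
    rcases h with h | h | h
    · exact ⟨(q.symm (Quotient.mk s y), 0), by simp only [hq]; exact h.symm⟩
    · exact ⟨(q.symm (Quotient.mk s y), 1), by simp only [hq]; exact h.symm⟩
    · exact ⟨(q.symm (Quotient.mk s y), 2), by simp only [hq]; exact h.symm⟩
  · rintro ⟨a, i⟩ ⟨b, j⟩
    refine Iff.trans ?_ ((hf _ _).trans (harc a b i j)).symm
    simp only [comp, kbar, dirCycle, false_or]
    have hi : ∀ i j : Fin 3, j = i + 1 ∧ i ≠ j ↔ j = i + 1 := by decide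
    have h := hi i j
    constructor
    · rintro ⟨h₁, h₂⟩
      exact ⟨h₁.symm, h.1 h₂⟩
    · rintro ⟨h₁, h₂⟩
      exact ⟨h₁.symm, h.2 h₂⟩

theorem iso_dirCycle_three_comp_kbar {n : ℕ} (p : V → ZMod 3)
    (hp : ∀ x y, M.arc x y ↔ p y = p x + 1) (hc : ∀ i, Nonempty ({x // p x = i} ≃ Fin n)) :
    M.Iso ((dirCycle 3).comp (kbar n)) := by
  let c := fun i => (hc i).some
  refine ⟨(Equiv.sigmaFiberEquiv p).symm.trans
    ((Equiv.sigmaCongrRight c).trans (Equiv.sigmaEquivProd (ZMod 3) (Fin n))), fun u v => ?_⟩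
  have hi : ∀ i j : ZMod 3, j = i + 1 ↔ (j = i + 1 ∧ i ≠ j) := by decide
  rw [hp, hi]
  simp [comp, kbar, dirCycle]

/-- An a-digraph whose arcs are given by the table of out-neighbours of `H0` is isomorphic
to `H0`. -/
theorem iso_H0_of_table (e : Fin 8 → V) (he : Function.Bijective e)
    (h : ∀ i z, M.arc (e i) z ↔ ∃ k : Fin 3, z = e ((![![1, 2, 3], ![2, 4, 5], ![3, 4, 6],
      ![1, 4, 7], ![5, 6, 7], ![0, 2, 6], ![0, 3, 7], ![0, 1, 5]] : Fin 8 → Fin 3 → Fin 8) i k)) :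
    M.Iso H0 := by
  let w : Fin 8 → {v : Fin 2 → ZMod 3 // v ≠ 0} :=
    ![⟨![1, 0], by decide⟩, ⟨![0, 1], by decide⟩, ⟨![2, 1], by decide⟩, ⟨![1, 1], by decide⟩,
      ⟨![2, 0], by decide⟩, ⟨![2, 2], by decide⟩, ⟨![0, 2], by decide⟩, ⟨![1, 2], by decide⟩]
  have hw : Function.Bijective w :=
    (Fintype.bijective_iff_injective_and_card w).2 ⟨by decide, by decide⟩
  refine iso_of_bijective (e ∘ (Equiv.ofBijective w hw).symm)
    (he.comp (Equiv.bijective _)) fun u v => ?_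
  obtain ⟨i, rfl⟩ := hw.2 u
  obtain ⟨j, rfl⟩ := hw.2 v
  simp only [Function.comp, Equiv.ofBijective_symm_apply_apply, h, he.1.eq_iff]
  revert i j
  simp only [H0]
  decide

end Recognition

section Classification

variable {V : Type*} {M : ADigraph V}

theorem iso_of_nonadjacent_of_outdegree_one (hM : M.IsA) {f : V → V}
    (hf : ∀ x z, M.arc x z ↔ z = f x) (hinj : Function.Injective f)
    (h : ∀ x y, x ≠ y → ¬ M.arc x y → ¬ M.arc y x →
      (∀ z, M.arc x z ↔ M.arc z y) ∨ (∀ z, M.arc y z ↔ M.arc z x))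
    (hex : ∃ x y, x ≠ y ∧ ¬ M.arc x y ∧ ¬ M.arc y x) :
    M.Iso (dirCycle 4) ∨ M.Iso (dirCycle 5) := by
  have h₁ : ∀ x, f x ≠ x := fun x hx => hM.1 x ((hf _ _).2 hx.symm)
  have h₂ : ∀ x, f (f x) ≠ x := fun x hx =>
    hM.2 _ _ ((hf x _).2 rfl) ((hf _ _).2 hx.symm)
  have hnon : ∀ x y, y = x ∨ y = f x ∨ x = f y ∨ y = f (f x) ∨ x = f (f y) := by
    intro x y
    by_contra! hne
    rcases h x y hne.1.symm (by rw [hf]; exact hne.2.1) (by rw [hf]; exact hne.2.2.1) with h' | h'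
    · exact hne.2.2.2.1 ((hf _ _).1 ((h' _).1 ((hf _ _).2 rfl)))
    · exact hne.2.2.2.2 ((hf _ _).1 ((h' _).1 ((hf _ _).2 rfl)))
  obtain ⟨x, hx⟩ : ∃ x, f (f (f x)) ≠ x := by
    obtain ⟨x, y, hxy, hxy₁, hxy₂⟩ := hex
    rw [hf] at hxy₁ hxy₂
    by_contra! h₃
    rcases hnon x y with h' | h' | h' | h' | h'
    · exact hxy h'.symm
    · exact hxy₁ h'
    · exact hxy₂ h'
    · exact hxy₂ (by rw [h', h₃])
    · exact hxy₁ (by rw [h', h₃])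
  have hV : ∀ y, y = x ∨ y = f x ∨ x = f y ∨ y = f (f x) ∨ x = f (f y) := hnon x
  rcases hV (f (f (f x))) with h' | h' | h' | h' | h'
  · exact absurd h' hx
  · exact absurd (hinj h') (h₂ _)
  · left
    refine iso_dirCycle_four hf x (h₁ x) (h₂ x) hx h'.symm hinj fun y => ?_
    rcases hV y with h | h | h | h | h
    · exact Or.inl h
    · exact Or.inr (Or.inl h)
    · exact Or.inr (Or.inr (Or.inr (hinj (h.symm.trans h'))))
    · exact Or.inr (Or.inr (Or.inl h))
    · exact Or.inr (Or.inr (Or.inl (hinj (hinj (h.symm.trans h')))))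
  · exact absurd (hinj (hinj h')) (h₁ _)
  · by_cases h₄ : f (f (f (f x))) = x
    · exact absurd (h₄.trans h') (by
        intro e
        exact h₁ _ (hinj (hinj (hinj (hinj e.symm)))))
    right
    refine iso_dirCycle_five hf x (h₁ x) (h₂ x) hx h₄ h'.symm hinj fun y => ?_
    rcases hV y with h | h | h | h | h
    · exact Or.inl h
    · exact Or.inr (Or.inl h)
    · exact Or.inr (Or.inr (Or.inr (Or.inr (hinj (h.symm.trans h')))))
    · exact Or.inr (Or.inr (Or.inl h))
    · exact Or.inr (Or.inr (Or.inr (Or.inl (hinj (hinj (h.symm.trans h'))))))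

/-- If the in-neighbours of the tail of each arc are the out-neighbours of its head, and
every nonadjacent pair has a common in-neighbour, then the a-digraph is a blown-up directed
triangle. -/
theorem iso_dirCycle_three_comp_kbar_of_reciprocal [Finite V] (hM : M.IsA)
    (h : ∀ x y, M.arc x y → ∀ z, M.arc z x ↔ M.arc y z) {α β : V} (hαβ : M.arc α β)
    (hcom : ∀ x y, x ≠ y → ¬ M.arc x y → ¬ M.arc y x → ∃ z, M.arc z x ∧ M.arc z y)
    (hin : ∀ y, ∃ x, M.arc x y)
    (hcard : ∀ x y, Nonempty ({z // M.arc x z} ≃ {z // M.arc y z})) :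
    ∃ n : ℕ, 1 ≤ n ∧ M.Iso ((dirCycle 3).comp (kbar n)) := by
  obtain ⟨γ, hγ⟩ := hin α
  have hβγ : M.arc β γ := (h _ _ hαβ γ).1 hγ
  have hpart : ∀ x, M.arc γ x ∨ M.arc α x ∨ M.arc β x := fun x => by
    by_cases hx : x = α
    · exact Or.inl (hx ▸ hγ)
    by_cases hx₁ : M.arc α x
    · exact Or.inr (Or.inl hx₁)
    by_cases hx₂ : M.arc x α
    · exact Or.inr (Or.inr ((h _ _ hαβ x).1 hx₂))
    obtain ⟨z, hz, hzα⟩ := hcom x α hx hx₂ hx₁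
    left
    have hβz := (h _ _ hzα β).2 hαβ
    rwa [← h _ _ hβγ, h _ _ hβz]
  have hdisj : ∀ a b x, M.arc a b → M.arc a x → ¬ M.arc b x := fun a b x hab hax hbx =>
    hM.2 _ _ hax ((h _ _ hbx a).1 hab)
  have h₀ : ∀ x, M.arc γ x → ∀ z, M.arc x z ↔ M.arc α z := fun x hx z =>
    (h _ _ hx z).symm.trans (h _ _ hγ z)
  have h₁ : ∀ x, M.arc α x → ∀ z, M.arc x z ↔ M.arc β z := fun x hx z =>
    (h _ _ hx z).symm.trans (h _ _ hαβ z)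
  have h₂ : ∀ x, M.arc β x → ∀ z, M.arc x z ↔ M.arc γ z := fun x hx z =>
    (h _ _ hx z).symm.trans (h _ _ hβγ z)
  have hp : ∀ x, ∃ i : ZMod 3,
      (i = 0 ↔ M.arc γ x) ∧ (i = 1 ↔ M.arc α x) ∧ (i = 2 ↔ M.arc β x) := fun x => by
    have d₀ := hdisj γ α x hγ
    have d₁ := hdisj α β x hαβ
    have d₂ := hdisj β γ x hβγ
    rcases hpart x with hx | hx | hx
    · exact ⟨0, iff_of_true rfl hx, iff_of_false (by decide) (d₀ hx),
        iff_of_false (by decide) fun e => d₂ e hx⟩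
    · exact ⟨1, iff_of_false (by decide) fun e => d₀ e hx, iff_of_true rfl hx,
        iff_of_false (by decide) (d₁ hx)⟩
    · exact ⟨2, iff_of_false (by decide) (d₂ hx), iff_of_false (by decide) fun e => d₁ e hx,
        iff_of_true rfl hx⟩
  choose p p₀ p₁ p₂ using hp
  have a₀ : (0 : ZMod 3) + 1 = 1 := by decide
  have a₁ : (1 : ZMod 3) + 1 = 2 := by decide
  have a₂ : (2 : ZMod 3) + 1 = 0 := by decide
  have : Nonempty {z // M.arc α z} := ⟨⟨β, hαβ⟩⟩
  refine ⟨Nat.card {z // M.arc α z}, Nat.card_pos,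
    iso_dirCycle_three_comp_kbar p (fun x y => ?_) fun i => ?_⟩
  · rcases hpart x with hx | hx | hx
    · rw [(p₀ x).2 hx, a₀, p₁, h₀ x hx]
    · rw [(p₁ x).2 hx, a₁, p₂, h₁ x hx]
    · rw [(p₂ x).2 hx, a₂, p₀, h₂ x hx]
  · have key : ∀ x, (∀ z, p z = i ↔ M.arc x z) →
        Nonempty ({z // p z = i} ≃ Fin (Nat.card {z // M.arc α z})) := fun x hx =>
      (hcard x α).map fun c =>
        ((Equiv.subtypeEquivRight hx).trans c).trans (Finite.equivFin _)
    have hi : ∀ i : ZMod 3, i = 0 ∨ i = 1 ∨ i = 2 := by decide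
    rcases hi i with rfl | rfl | rfl
    exacts [key γ p₀, key α p₁, key β p₂]

/-- A directed triangle in an out-neighbourhood that is a directed triangle. -/
theorem exists_third_outNeighbour (hM : M.IsA)
    (h₃ : ∀ x, ∃ a b c, M.arc a b ∧ M.arc b c ∧ M.arc c a ∧ ∀ z, M.arc x z ↔ z = a ∨ z = b ∨ z = c)
    {x u v : V} (hxu : M.arc x u) (hxv : M.arc x v) (huv : M.arc u v) :
    ∃ w, M.arc v w ∧ M.arc w u ∧ ∀ z, M.arc x z ↔ z = u ∨ z = v ∨ z = w := by
  obtain ⟨a, b, c, hab, hbc, hca, hz⟩ := h₃ x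
  have hu := (hz u).1 hxu
  have hv := (hz v).1 hxv
  have h₁ := hM.1
  have h₂ := hM.2
  rcases hu with rfl | rfl | rfl <;> rcases hv with rfl | rfl | rfl
  · exact absurd huv (h₁ _)
  · exact ⟨c, hbc, hca, hz⟩
  · exact absurd huv (h₂ _ _ hca)
  · exact absurd huv (h₂ _ _ hab)
  · exact absurd huv (h₁ _)
  · exact ⟨a, hca, hab, fun z => by rw [hz]; tauto⟩
  · exact ⟨b, hab, hbc, fun z => by rw [hz]; tauto⟩
  · exact absurd huv (h₂ _ _ hbc)
  · exact absurd huv (h₁ _)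

theorem iso_H0_of_nonadjacent (hM : M.IsA)
    (h : ∀ x y, x ≠ y → ¬ M.arc x y → ¬ M.arc y x →
      (∀ z, M.arc x z ↔ M.arc z y) ∨ (∀ z, M.arc y z ↔ M.arc z x))
    (h₃ : ∀ x, ∃ a b c, M.arc a b ∧ M.arc b c ∧ M.arc c a ∧ ∀ z, M.arc x z ↔ z = a ∨ z = b ∨ z = c)
    {α σ : V} (hne : α ≠ σ) (hασ : ¬ M.arc α σ) (hσα : ¬ M.arc σ α)
    (hσ : ∀ z, M.arc α z ↔ M.arc z σ)
    (hin : ∃ g : V ≃ V, ∀ z, M.arc α z ↔ M.arc (g z) α) : M.Iso H0 := by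
  have hanti := hM.2
  obtain ⟨b₀, b₁, b₂, h₀₁, h₁₂, h₂₀, hα⟩ := h₃ α
  have hα₀ : M.arc α b₀ := by simp [hα]
  have hα₁ : M.arc α b₁ := by simp [hα]
  have hα₂ : M.arc α b₂ := by simp [hα]
  have hthird : ∀ b b', M.arc α b → M.arc α b' → M.arc b b' →
      ∃ y, M.arc σ y ∧ M.arc y b' ∧ M.arc y α ∧
        ∀ z, M.arc b z ↔ z = b' ∨ z = σ ∨ z = y := by
    intro b b' hb hb' hbb'
    obtain ⟨y, hσy, hyb', hby⟩ :=
      exists_third_outNeighbour hM h₃ hbb' ((hσ b).1 hb) ((hσ b').1 hb')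
    refine ⟨y, hσy, hyb', ?_, hby⟩
    by_contra hyα
    have hby' : M.arc b y := by simp [hby]
    rcases h y α (by rintro rfl; exact hanti _ _ hb hby') hyα
      (fun hαy => hanti _ _ ((hσ y).1 hαy) hσy) with h' | h'
    · exact hanti _ _ hb' ((h' b').1 hyb')
    · exact hanti _ _ hyb' ((h' b').1 hb')
  obtain ⟨y₀, hσ₀, hy₀₁, hy₀, hb₀⟩ := hthird b₀ b₁ hα₀ hα₁ h₀₁
  obtain ⟨y₁, hσ₁, hy₁₂, hy₁, hb₁⟩ := hthird b₁ b₂ hα₁ hα₂ h₁₂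
  obtain ⟨y₂, hσ₂, hy₂₀, hy₂, hb₂⟩ := hthird b₂ b₀ hα₂ hα₀ h₂₀
  have hby₀ : M.arc b₀ y₀ := by simp [hb₀]
  have hby₁ : M.arc b₁ y₁ := by simp [hb₁]
  have hby₂ : M.arc b₂ y₂ := by simp [hb₂]
  have hy₀₁' : y₀ ≠ y₁ := by rintro rfl; exact hanti _ _ hy₀₁ hby₁
  have hy₁₂' : y₁ ≠ y₂ := by rintro rfl; exact hanti _ _ hy₁₂ hby₂
  have hy₂₀' : y₂ ≠ y₀ := by rintro rfl; exact hanti _ _ hy₂₀ hby₀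
  have hσz : ∀ z, M.arc σ z ↔ z = y₀ ∨ z = y₁ ∨ z = y₂ := by
    obtain ⟨a, b, c, -, -, -, hz⟩ := h₃ σ
    have := (hz _).1 hσ₀
    have := (hz _).1 hσ₁
    have := (hz _).1 hσ₂
    intro z
    rw [hz]
    grind
  have hzα : ∀ z, M.arc z α ↔ z = y₀ ∨ z = y₁ ∨ z = y₂ := by
    obtain ⟨g, hg⟩ := hin
    have hz : ∀ z, M.arc z α ↔ z = g b₀ ∨ z = g b₁ ∨ z = g b₂ := fun z => by
      have := hg (g.symm z)
      rw [g.apply_symm_apply] at this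
      rw [← this, hα]
      simp [Equiv.symm_apply_eq]
    have := (hz _).1 hy₀
    have := (hz _).1 hy₁
    have := (hz _).1 hy₂
    intro z
    rw [hz]
    grind
  have hy : ∀ y b b' y', M.arc y α → M.arc y b → M.arc α b → M.arc α b' → M.arc b b' →
      (∀ z, M.arc b z ↔ z = b' ∨ z = σ ∨ z = y') →
      ∀ z, M.arc y z ↔ z = α ∨ z = b ∨ z = y' := by
    intro y b b' y' hyα hyb hαb hαb' hbb' hbz
    obtain ⟨w, hbw, hwα, hw⟩ := exists_third_outNeighbour hM h₃ hyα hyb hαb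
    rcases (hbz w).1 hbw with rfl | rfl | rfl
    · exact absurd hwα (hanti _ _ hαb')
    · exact absurd hwα hσα
    · exact hw
  have hy₀z := hy y₀ b₁ b₂ y₁ hy₀ hy₀₁ hα₁ hα₂ h₁₂ hb₁
  have hy₁z := hy y₁ b₂ b₀ y₂ hy₁ hy₁₂ hα₂ hα₀ h₂₀ hb₂
  have hy₂z := hy y₂ b₀ b₁ y₀ hy₂ hy₂₀ hα₀ hα₁ h₀₁ hb₀
  have hV : ∀ z, z = α ∨ M.arc α z ∨ M.arc z α ∨ z = σ := by
    intro z
    by_contra! hz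
    obtain ⟨hz₁, hz₂, hz₃, hz₄⟩ := hz
    rcases h α z (Ne.symm hz₁) hz₂ hz₃ with h' | h'
    · rcases (hb₀ z).1 ((h' b₀).1 hα₀) with rfl | rfl | rfl
      exacts [hz₂ hα₁, hz₄ rfl, hz₃ hy₀]
    · have hzy := (h' y₀).2 hy₀
      rcases h z σ hz₄ (fun e => hz₂ ((hσ z).2 e))
        (fun e => hz₃ ((hzα z).2 ((hσz z).1 e))) with h'' | h''
      · exact hanti _ _ hσ₀ ((h'' y₀).1 hzy)
      · exact hanti _ _ hzy ((h'' y₀).1 hσ₀)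
  have hby : ∀ b y, M.arc α b → M.arc y α → b ≠ y ∧ y ≠ b := fun b y hb hy =>
    ⟨fun e => hanti _ _ hb (e ▸ hy), fun e => hanti _ _ hb (e ▸ hy)⟩
  refine iso_H0_of_table ![α, b₀, b₁, b₂, σ, y₀, y₁, y₂] ⟨?_, fun z => ?_⟩ fun i z => ?_
  · have hb : ∀ b, M.arc α b → α ≠ b ∧ b ≠ α ∧ σ ≠ b ∧ b ≠ σ := fun b hb =>
      ⟨hM.ne hb, (hM.ne hb).symm, (hM.ne ((hσ b).1 hb)).symm, hM.ne ((hσ b).1 hb)⟩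
    have hy : ∀ y, M.arc y α → α ≠ y ∧ y ≠ α ∧ σ ≠ y ∧ y ≠ σ := fun y hy =>
      have e := hM.ne ((hσz y).2 ((hzα y).1 hy))
      ⟨(hM.ne hy).symm, hM.ne hy, e, e.symm⟩
    intro i j hij
    fin_cases i <;> fin_cases j <;>
      first
      | rfl
      | (exfalso
         simp [hb _ hα₀, hb _ hα₁, hb _ hα₂, hy _ hy₀, hy _ hy₁, hy _ hy₂, hne, hne.symm,
          hby _ _ hα₀ hy₀, hby _ _ hα₀ hy₁, hby _ _ hα₀ hy₂,
          hby _ _ hα₁ hy₀, hby _ _ hα₁ hy₁, hby _ _ hα₁ hy₂,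
          hby _ _ hα₂ hy₀, hby _ _ hα₂ hy₁, hby _ _ hα₂ hy₂,
          hM.ne h₀₁, (hM.ne h₀₁).symm, hM.ne h₁₂, (hM.ne h₁₂).symm, hM.ne h₂₀, (hM.ne h₂₀).symm,
          hy₀₁', hy₀₁'.symm, hy₁₂', hy₁₂'.symm, hy₂₀', hy₂₀'.symm] at hij)
  · rcases hV z with rfl | hz | hz | rfl
    · exact ⟨0, rfl⟩
    · rcases (hα z).1 hz with rfl | rfl | rfl
      exacts [⟨1, rfl⟩, ⟨2, rfl⟩, ⟨3, rfl⟩]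
    · rcases (hzα z).1 hz with rfl | rfl | rfl
      exacts [⟨5, rfl⟩, ⟨6, rfl⟩, ⟨7, rfl⟩]
    · exact ⟨4, rfl⟩
  · rw [Fin.exists_fin_succ, Fin.exists_fin_two]
    fin_cases i
    · exact hα z
    · exact hb₀ z
    · exact hb₁ z
    · exact (hb₂ z)
    · exact hσz z
    · exact hy₀z z
    · exact hy₁z z
    · exact (hy₂z z)

end Classification

end ADigraph

/-- A finite set-homogeneous a-digraph with a vertex whose
out- and in-neighbourhoods induce isomorphic subdigraphs is isomorphic to one
of `D₁`, `D₃`, `D₄`, `D₅`, `H₀`, `K̄_n`, `K̄_n[D₃]`, `D₃[K̄_n]` with `n ≥ 1`. -/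
theorem finite_set_homogeneous_adigraph_isomorphic_nbhds
    {V : Type} [Fintype V] (M : ADigraph V) (hM : M.IsA)
    (hsh : M.SetHomogeneous) (α : V)
    (hiso : (M.induce {x | M.arc α x}).Iso (M.induce {x | M.arc x α})) :
    M.Iso (dirCycle 1) ∨ M.Iso (dirCycle 3) ∨ M.Iso (dirCycle 4) ∨
      M.Iso (dirCycle 5) ∨ M.Iso H0 ∨
      ∃ n : ℕ, 1 ≤ n ∧
        (M.Iso (kbar n) ∨ M.Iso ((kbar n).comp (dirCycle 3)) ∨
          M.Iso ((dirCycle 3).comp (kbar n))) := by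
  have : Nonempty V := ⟨α⟩
  have hirr := hM.1
  have hanti := hM.2
  have hio := hsh.exists_inNbhd_eq_outNbhd hM α hiso
  by_cases harc : ∀ x y, ¬ M.arc x y
  · exact Or.inr (Or.inr (Or.inr (Or.inr (Or.inr
      ⟨_, Fintype.card_pos, Or.inl (iso_kbar_card harc)⟩))))
  push Not at harc
  obtain ⟨β, hβ⟩ : ∃ β, M.arc α β := by
    obtain ⟨x, y, hxy⟩ := harc
    obtain ⟨g, hg, hgx⟩ := hsh.exists_apply_eq hM x α
    exact ⟨g y, hgx ▸ (hg x y).1 hxy⟩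
  have hout : ∀ x, ∃ y, M.arc x y := fun x => by
    obtain ⟨g, hg, hgx⟩ := hsh.exists_apply_eq hM α x
    exact ⟨g β, hgx ▸ (hg α β).1 hβ⟩
  have hin : ∀ y, ∃ x, M.arc x y := fun y => by
    obtain ⟨g, -, hg⟩ := hio α y
    exact ⟨g β, (hg β).1 hβ⟩
  obtain ⟨ζ, hζ⟩ : ∃ ζ, ∀ z, M.arc α z ↔ M.arc z ζ := by
    obtain ⟨g, hg, hgz⟩ := hio α α
    refine ⟨g.symm α, fun z => ?_⟩
    rw [hgz, hg z, g.apply_symm_apply]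
  have hαζ : ¬ M.arc α ζ := fun h => hirr _ ((hζ ζ).1 h)
  have hne : α ≠ ζ := by
    rintro rfl
    exact hanti _ _ hβ ((hζ β).1 hβ)
  have hinj : ∀ f : V → V, (∀ x z, M.arc x z ↔ z = f x) → Function.Injective f := fun f hf =>
    Finite.injective_iff_surjective.2 fun y => by
      obtain ⟨x, hx⟩ := hin y
      exact ⟨x, ((hf _ _).1 hx).symm⟩
  have hone : (∀ z, M.arc α z ↔ z = β) → ∃ f : V → V, ∀ x z, M.arc x z ↔ z = f x := fun h => by
    have : ∀ x, ∃ y, ∀ z, M.arc x z ↔ z = y := fun x => by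
      obtain ⟨g, hg, hgx⟩ := hsh.exists_apply_eq hM x α
      exact ⟨g.symm β, fun z => by rw [hg, hgx, h, Equiv.eq_symm_apply]⟩
    exact ⟨fun x => (this x).choose, fun x => (this x).choose_spec⟩
  by_cases hζα : M.arc ζ α
  · have hrec : ∀ x y, M.arc x y → ∀ z, M.arc z x ↔ M.arc y z := fun x y hxy z => by
      obtain ⟨g, hg, hgx, hgy⟩ := hsh.exists_apply_arc hM hxy hζα
      rw [hg z, hg y, hgx, hgy, hζ]
    by_cases h₁ : ∀ z, M.arc α z ↔ z = β
    · obtain ⟨f, hf⟩ := hone h₁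
      obtain ⟨n, hn, h⟩ := iso_kbar_comp_dirCycle_three hf
        (fun x hx => hirr x ((hf _ _).2 hx.symm)) fun x => by
          obtain ⟨y, hy⟩ := hin x
          rw [← (hf _ _).1 ((hrec _ _ ((hf x _).2 rfl) y).1 hy), ← (hf _ _).1 hy]
      exact Or.inr (Or.inr (Or.inr (Or.inr (Or.inr ⟨n, hn, Or.inr (Or.inl h)⟩))))
    · obtain ⟨β', hβ', hne'⟩ : ∃ β', M.arc α β' ∧ β' ≠ β := by
        by_contra! h
        exact h₁ fun z => ⟨h z, fun e => e ▸ hβ⟩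
      have hind : ∀ b c, M.arc α b → M.arc α c → ¬ M.arc b c := fun b c hb hc hbc =>
        hanti _ _ hc ((hrec _ _ hbc α).1 hb)
      obtain ⟨n, hn, h⟩ := iso_dirCycle_three_comp_kbar_of_reciprocal hM hrec hβ
        (fun x y hxy h h' => by
          obtain ⟨g, hg, hgxy⟩ := hsh.exists_image_pair hM hne' hxy
            (iff_of_false (hind _ _ hβ' hβ) h) (iff_of_false (hind _ _ hβ hβ') h')
          have h₂ := (hg _ _).1 hβ
          have h₃ := (hg _ _).1 hβ'
          rcases hgxy with ⟨e, e'⟩ | ⟨e, e'⟩ <;> rw [e'] at h₂ <;> rw [e] at h₃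
          exacts [⟨_, h₃, h₂⟩, ⟨_, h₂, h₃⟩]) hin
        (fun x y => by
          obtain ⟨g, hg, hgx⟩ := hsh.exists_apply_eq hM x y
          exact ⟨g.subtypeEquiv fun z => by rw [hg, hgx]⟩)
      exact Or.inr (Or.inr (Or.inr (Or.inr (Or.inr ⟨n, hn, Or.inr (Or.inr h)⟩))))
  · have hrec : ∀ x y, x ≠ y → ¬ M.arc x y → ¬ M.arc y x →
        (∀ z, M.arc x z ↔ M.arc z y) ∨ (∀ z, M.arc y z ↔ M.arc z x) := fun x y hxy h h' => by
      obtain ⟨g, hg, ⟨e, e'⟩ | ⟨e, e'⟩⟩ := hsh.exists_image_pair hM hxy hne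
        (iff_of_false h hαζ) (iff_of_false h' hζα)
      · exact Or.inl fun z => by rw [hg x, hg z, e, e', hζ]
      · exact Or.inr fun z => by rw [hg y, hg z, e, e', hζ]
    have htour : ∀ w x y, M.arc w x → M.arc w y → x ≠ y → M.arc x y ∨ M.arc y x := by
      intro w x y hx hy hxy
      by_contra! h
      rcases hrec x y hxy h.1 h.2 with h' | h'
      · exact hanti _ _ hx ((h' w).2 hy)
      · exact hanti _ _ hy ((h' w).2 hx)
    by_cases h₁ : ∀ z, M.arc α z ↔ z = β
    · obtain ⟨f, hf⟩ := hone h₁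
      rcases iso_of_nonadjacent_of_outdegree_one hM hf (hinj f hf) hrec
        ⟨α, ζ, hne, hαζ, hζα⟩ with h | h
      · exact Or.inr (Or.inr (Or.inl h))
      · exact Or.inr (Or.inr (Or.inr (Or.inl h)))
    · refine Or.inr (Or.inr (Or.inr (Or.inr (Or.inl
        (iso_H0_of_nonadjacent hM hrec (fun x => ?_) hne hαζ hζα hζ ?_)))))
      · obtain ⟨y, hy⟩ := hout x
        rcases outNbhd_eq_of_tournament hM hsh hio hy (htour x) with h | ⟨b, c, h, h', h'', hz⟩
        · refine absurd (fun z => ?_) h₁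
          obtain ⟨g, hg, hgx⟩ := hsh.exists_apply_eq hM α x
          have hgβ := (hg _ _).1 hβ
          rw [hgx, h] at hgβ
          rw [hg, hgx, h, ← hgβ, g.injective.eq_iff]
        · exact ⟨y, b, c, h, h', h'', hz⟩
      · obtain ⟨g, -, hg⟩ := hio α α
        exact ⟨g, hg⟩
end

section
/- Let M be a finite set-homogeneous s-digraph, let α be a vertex of M, let β ∈ Γ(α) and let γ ∈ Γ*(α). Then the s-digraphs induced on Γ(α) ∩ Γ*(β) and on Γ(γ) ∩ Γ*(α) are isomorphic. -/
open SDigraph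

/-- A bijection between two vertex sets that preserves and reflects both relations is an
isomorphism of the induced sub-s-digraphs. -/
theorem SDigraph.iso_induce_of_bijOn {V W : Type*} {M : SDigraph V} {N : SDigraph W} {f : V → W}
    {S : Set V} {T : Set W} (hf : Set.BijOn f S T)
    (harc : ∀ u ∈ S, ∀ v ∈ S, M.arc u v ↔ N.arc (f u) (f v))
    (hedge : ∀ u ∈ S, ∀ v ∈ S, M.edge u v ↔ N.edge (f u) (f v)) :
    (M.induce S).Iso (N.induce T) :=
  ⟨hf.equiv f, fun u v => harc u u.2 v v.2, fun u v => hedge u u.2 v v.2⟩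

/-- Any two arcs of an s-digraph induce isomorphic sub-s-digraphs. -/
theorem SDigraph.IsS.iso_induce_pair {V : Type*} {M : SDigraph V} (hM : M.IsS) {a b c d : V}
    (hab : M.arc a b) (hcd : M.arc c d) :
    (M.induce {a, b}).Iso (M.induce {c, d}) := by
  classical
  obtain ⟨hirr, hanti, heirr, hesymm, hdisj⟩ := hM
  have hba : b ≠ a := by rintro rfl; exact hirr _ hab
  have hcd' : c ≠ d := by rintro rfl; exact hirr _ hcd
  have hba_arc := hanti _ _ hab
  have hdc_arc := hanti _ _ hcd
  have hab_edge : ¬ M.edge a b := fun h => hdisj _ _ h hab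
  have hcd_edge : ¬ M.edge c d := fun h => hdisj _ _ h hcd
  have hba_edge : ¬ M.edge b a := fun h => hab_edge (hesymm _ _ h)
  have hdc_edge : ¬ M.edge d c := fun h => hcd_edge (hesymm _ _ h)
  refine iso_induce_of_bijOn (f := fun x => if x = a then c else d) ⟨?_, ?_, ?_⟩ ?_ ?_
  · rintro x (rfl | rfl) <;> simp [hba]
  · rintro x (rfl | rfl) y (rfl | rfl) <;> simp [hba, hcd', hcd'.symm]
  · rintro x (rfl | rfl)
    · exact ⟨a, by simp, by simp⟩
    · exact ⟨b, by simp, by simp [hba]⟩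
  · rintro x (rfl | rfl) y (rfl | rfl) <;> simp [*]
  · rintro x (rfl | rfl) y (rfl | rfl) <;> simp [*]

/-- In a set-homogeneous s-digraph the automorphisms act transitively on the arcs. -/
theorem SDigraph.SetHomogeneous.exists_isAuto_of_arc {V : Type*} {M : SDigraph V}
    (hsh : M.SetHomogeneous) (hM : M.IsS) {a b c d : V} (hab : M.arc a b) (hcd : M.arc c d) :
    ∃ g : V ≃ V, M.IsAuto g ∧ g a = c ∧ g b = d := by
  obtain ⟨g, hg, hgU⟩ :=
    hsh {a, b} {c, d} (Set.toFinite _) (Set.toFinite _) (hM.iso_induce_pair hab hcd)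
  have hgab : M.arc (g a) (g b) := (hg.1 a b).1 hab
  have ha : g a ∈ ({c, d} : Set V) := hgU ▸ Set.mem_image_of_mem g (by simp)
  have hb : g b ∈ ({c, d} : Set V) := hgU ▸ Set.mem_image_of_mem g (by simp)
  refine ⟨g, hg, ?_⟩
  rcases ha with ha | ha <;> rcases hb with hb | hb <;> rw [ha, hb] at hgab
  · exact absurd hgab (hM.1 _)
  · exact ⟨ha, hb⟩
  · exact absurd hgab (hM.2.1 _ _ hcd)
  · exact absurd hgab (hM.1 _)

/-- In a finite set-homogeneous s-digraph, if `β ∈ Γ(α)`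
and `γ ∈ Γ*(α)` then the s-digraphs induced on `Γ(α) ∩ Γ*(β)` and on
`Γ(γ) ∩ Γ*(α)` are isomorphic. -/
theorem induced_common_neighbourhoods_iso
    {V : Type} [Fintype V] (M : SDigraph V) (hM : M.IsS)
    (hsh : M.SetHomogeneous) (α β γ : V)
    (hβ : M.arc α β) (hγ : M.arc γ α) :
    (M.induce ({x | M.arc α x} ∩ {x | M.arc x β})).Iso
      (M.induce ({x | M.arc γ x} ∩ {x | M.arc x α})) := by
  obtain ⟨g, hg, rfl, hgβ⟩ := hsh.exists_isAuto_of_arc hM hβ hγ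
  refine iso_induce_of_bijOn (f := g) ⟨?_, g.injective.injOn, ?_⟩
    (fun u _ v _ => hg.1 u v) (fun u _ v _ => hg.2 u v)
  · rintro x ⟨hx, hx'⟩
    exact ⟨(hg.1 _ _).1 hx, hgβ ▸ (hg.1 _ _).1 hx'⟩
  · rintro y ⟨hy, hy'⟩
    obtain ⟨x, rfl⟩ := g.surjective y
    exact ⟨x, ⟨(hg.1 _ _).2 hy, (hg.1 _ _).2 (hgβ.symm ▸ hy')⟩, rfl⟩
end

section
/- Let M be a finite set-homogeneous s-digraph with automorphism group G, suppose M contains an induced copy of the directed triangle D_3, and suppose that for every arc α → β of M the pointwise stabilizer of {α, β} in G is trivial. Then: (1) for every induced copy T of D_3 in M, the group induced on T by its setwise stabilizer in G is trivial, if and only if |Γ(β) ∩ Γ*(α)| = 3 for every arc α → β of M; and (2) for every induced copy T of D_3 in M, the group induced on T by its setwise stabilizer in G has order 3, if and only if |Γ(β) ∩ Γ*(α)| = 1 for every arc α → β of M. -/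
open SDigraph

/-- `{a, b, c}` is an induced copy of the directed triangle `D₃` in `M`. -/
def SDigraph.IsD3Copy {V : Type} (M : SDigraph V) (a b c : V) : Prop :=
  a ≠ b ∧ b ≠ c ∧ a ≠ c ∧ M.arc a b ∧ M.arc b c ∧ M.arc c a ∧
    ¬ M.arc b a ∧ ¬ M.arc c b ∧ ¬ M.arc a c ∧
    ¬ M.edge a b ∧ ¬ M.edge b c ∧ ¬ M.edge a c

/-- The group induced on `T` by its setwise stabilizer, realised as the set
of restrictions to `T` of automorphisms of `M` fixing `T` setwise. -/
def SDigraph.inducedMaps {V : Type} (M : SDigraph V) (T : Set V) :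
    Set (T → V) :=
  {f | ∃ g : V ≃ V, M.IsAuto g ∧ ⇑g '' T = T ∧ ∀ x : T, f x = g (x : V)}

namespace SDigraph

variable {V : Type} {M : SDigraph V}

theorem IsAuto.refl : M.IsAuto (Equiv.refl V) :=
  ⟨fun _ _ => Iff.rfl, fun _ _ => Iff.rfl⟩

theorem IsAuto.symm {g : V ≃ V} (hg : M.IsAuto g) : M.IsAuto g.symm :=
  ⟨fun u v => by simp [hg.1 (g.symm u)], fun u v => by simp [hg.2 (g.symm u)]⟩

theorem IsAuto.trans {g h : V ≃ V} (hg : M.IsAuto g) (hh : M.IsAuto h) :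
    M.IsAuto (g.trans h) :=
  ⟨fun u v => (hg.1 u v).trans (hh.1 _ _), fun u v => (hg.2 u v).trans (hh.2 _ _)⟩

/-- Set-homogeneity for finite sets presented as ranges of injective families. -/
theorem SetHomogeneous.exists_image_range {ι : Type*} [Finite ι] (hsh : M.SetHomogeneous)
    {f f' : ι → V} (hf : f.Injective) (hf' : f'.Injective)
    (harc : ∀ i j, M.arc (f i) (f j) ↔ M.arc (f' i) (f' j))
    (hedge : ∀ i j, M.edge (f i) (f j) ↔ M.edge (f' i) (f' j)) :
    ∃ g : V ≃ V, M.IsAuto g ∧ ⇑g '' Set.range f = Set.range f' := by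
  refine hsh _ _ (Set.finite_range f) (Set.finite_range f')
    ⟨(Equiv.ofInjective f hf).symm.trans (Equiv.ofInjective f' hf'), ?_, ?_⟩
  · rintro ⟨_, i, rfl⟩ ⟨_, j, rfl⟩
    simpa [induce, Equiv.ofInjective_symm_apply] using harc i j
  · rintro ⟨_, i, rfl⟩ ⟨_, j, rfl⟩
    simpa [induce, Equiv.ofInjective_symm_apply] using hedge i j

theorem IsS.ne_of_arc (hM : M.IsS) {a b : V} (h : M.arc a b) : a ≠ b := by
  rintro rfl
  exact hM.1 _ h

theorem IsS.not_edge_of_arc (hM : M.IsS) {a b : V} (h : M.arc a b) :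
    ¬ M.edge a b ∧ ¬ M.edge b a :=
  ⟨fun e => hM.2.2.2.2 _ _ e h, fun e => hM.2.2.2.2 _ _ (hM.2.2.2.1 _ _ e) h⟩

theorem IsS.isD3Copy (hM : M.IsS) {a b c : V} (hab : M.arc a b) (hbc : M.arc b c)
    (hca : M.arc c a) : M.IsD3Copy a b c :=
  ⟨hM.ne_of_arc hab, hM.ne_of_arc hbc, (hM.ne_of_arc hca).symm, hab, hbc, hca,
    hM.2.1 _ _ hab, hM.2.1 _ _ hbc, hM.2.1 _ _ hca, (hM.not_edge_of_arc hab).1,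
    (hM.not_edge_of_arc hbc).1, (hM.not_edge_of_arc hca).2⟩

/-- The automorphism group of a set-homogeneous s-digraph is transitive on arcs. -/
theorem SetHomogeneous.exists_map_arc (hsh : M.SetHomogeneous) (hM : M.IsS) {a b a' b' : V}
    (h : M.arc a b) (h' : M.arc a' b') :
    ∃ g : V ≃ V, M.IsAuto g ∧ g a = a' ∧ g b = b' := by
  have key : ∀ {x y : V}, M.arc x y → Function.Injective ![x, y] := by
    intro x y hxy i j hij
    have := hM.ne_of_arc hxy
    fin_cases i <;> fin_cases j <;> simp_all
  obtain ⟨g, hg, hgi⟩ := hsh.exists_image_range (key h) (key h')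
    (by
      intro i j
      fin_cases i <;> fin_cases j <;> simp [h, h', hM.1, hM.2.1 _ _ h, hM.2.1 _ _ h'])
    (by
      intro i j
      fin_cases i <;> fin_cases j <;>
        simp [hM.2.2.1, hM.not_edge_of_arc h, hM.not_edge_of_arc h'])
  refine ⟨g, hg, ?_⟩
  simp only [Matrix.range_cons, Matrix.range_empty, Set.union_empty, Set.singleton_union,
    Set.image_insert_eq, Set.image_singleton] at hgi
  have hga : g a = a' ∨ g a = b' := by
    have : g a ∈ ({a', b'} : Set V) := hgi ▸ (by simp)
    simpa using this
  have hgb : g b = a' ∨ g b = b' := by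
    have : g b ∈ ({a', b'} : Set V) := hgi ▸ (by simp)
    simpa using this
  have hgab := (hg.1 _ _).1 h
  rcases hga with hga | hga <;> rcases hgb with hgb | hgb <;> rw [hga, hgb] at hgab
  · exact (hM.1 _ hgab).elim
  · exact ⟨hga, hgb⟩
  · exact (hM.2.1 _ _ h' hgab).elim
  · exact (hM.1 _ hgab).elim

/-- An automorphism carrying one directed triangle onto another respects the cyclic order. -/
theorem IsAuto.cyclic_of_image_eq (hM : M.IsS) {g : V ≃ V} (hg : M.IsAuto g)
    {a b c a' b' c' : V} (hT : M.IsD3Copy a b c) (hT' : M.IsD3Copy a' b' c')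
    (hgi : ⇑g '' {a, b, c} = {a', b', c'}) :
    (g a = a' ∧ g b = b' ∧ g c = c') ∨ (g a = b' ∧ g b = c' ∧ g c = a') ∨
      (g a = c' ∧ g b = a' ∧ g c = b') := by
  obtain ⟨-, -, -, hab, hbc, hca, -⟩ := hT
  obtain ⟨-, -, -, -, -, -, hba', hcb', hac', -⟩ := hT'
  have mem : ∀ x ∈ ({a, b, c} : Set V), g x = a' ∨ g x = b' ∨ g x = c' := by
    intro x hx
    have : g x ∈ ({a', b', c'} : Set V) := hgi ▸ Set.mem_image_of_mem g hx
    simpa using this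
  have hga := mem a (by simp)
  have hgb := mem b (by simp)
  have hgc := mem c (by simp)
  have hgab := (hg.1 _ _).1 hab
  have hgbc := (hg.1 _ _).1 hbc
  have hgca := (hg.1 _ _).1 hca
  have irr := hM.1
  grind

/-- A set-homogeneous s-digraph is transitive on directed triangles, up to rotation. -/
theorem SetHomogeneous.exists_map_triangle (hsh : M.SetHomogeneous) (hM : M.IsS)
    {a b c a' b' c' : V} (hT : M.IsD3Copy a b c) (hT' : M.IsD3Copy a' b' c') :
    ∃ g : V ≃ V, M.IsAuto g ∧ ((g a = a' ∧ g b = b' ∧ g c = c') ∨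
      (g a = b' ∧ g b = c' ∧ g c = a') ∨ (g a = c' ∧ g b = a' ∧ g c = b')) := by
  have key : ∀ {x y z : V}, M.IsD3Copy x y z → Function.Injective ![x, y, z] := by
    rintro x y z ⟨hxy, hyz, hxz, -⟩ i j hij
    fin_cases i <;> fin_cases j <;> simp_all
  have hTT := hT
  have hTT' := hT'
  obtain ⟨-, -, -, h1, h2, h3, h4, h5, h6, -⟩ := hTT
  obtain ⟨-, -, -, k1, k2, k3, k4, k5, k6, -⟩ := hTT'
  obtain ⟨g, hg, hgi⟩ := hsh.exists_image_range (key hT) (key hT')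
    (by
      intro i j
      fin_cases i <;> fin_cases j <;> simp [hM.1, *])
    (by
      intro i j
      fin_cases i <;> fin_cases j <;>
        simp [hM.2.2.1, hM.not_edge_of_arc h1, hM.not_edge_of_arc h2, hM.not_edge_of_arc h3,
          hM.not_edge_of_arc k1, hM.not_edge_of_arc k2, hM.not_edge_of_arc k3])
  refine ⟨g, hg, hg.cyclic_of_image_eq hM hT hT' ?_⟩
  simpa only [Matrix.range_cons, Matrix.range_empty, Set.union_empty,
    Set.singleton_union] using hgi

/-- Every arc of a set-homogeneous s-digraph embedding `D₃` lies in a directed triangle. -/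
theorem SetHomogeneous.exists_isD3Copy_of_arc (hsh : M.SetHomogeneous) (hM : M.IsS)
    (hD3 : ∃ a b c : V, M.IsD3Copy a b c) {a b : V} (h : M.arc a b) :
    ∃ c, M.IsD3Copy a b c := by
  obtain ⟨x, y, z, -, -, -, hxy, hyz, hzx, -⟩ := hD3
  obtain ⟨g, hg, rfl, rfl⟩ := hsh.exists_map_arc hM hxy h
  exact ⟨g z, hM.isD3Copy h ((hg.1 _ _).1 hyz) ((hg.1 _ _).1 hzx)⟩

theorem eq_of_eqOn_arc (hstab : ∀ α β : V, M.arc α β → ∀ g : V ≃ V, M.IsAuto g →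
      g α = α → g β = β → g = Equiv.refl V) {a b : V} (h : M.arc a b) {g g' : V ≃ V}
    (hg : M.IsAuto g) (hg' : M.IsAuto g') (ha : g a = g' a) (hb : g b = g' b) : g = g' := by
  have := hstab a b h (g.trans g'.symm) (hg.trans hg'.symm) (by simp [ha]) (by simp [hb])
  ext x
  have hx := congrArg (fun e : V ≃ V => g' (e x)) this
  simpa using hx

/-- The third vertices of the directed triangles on an arc `a → b`, in terms of the two
automorphisms carrying the other arcs of a directed triangle `a → b → c → a` to `a → b`. -/
theorem SetHomogeneous.common_eq (hsh : M.SetHomogeneous) (hM : M.IsS)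
    (hstab : ∀ α β : V, M.arc α β → ∀ g : V ≃ V, M.IsAuto g →
      g α = α → g β = β → g = Equiv.refl V) {a b c : V} (hT : M.IsD3Copy a b c)
    {g h : V ≃ V} (hg : M.IsAuto g) (hgb : g b = a) (hgc : g c = b)
    (hh : M.IsAuto h) (hhc : h c = a) (hha : h a = b) :
    {x | M.arc b x} ∩ {x | M.arc x a} = {c, g a, h b} := by
  have hTT := hT
  obtain ⟨-, -, -, hab, hbc, hca, -⟩ := hTT
  ext x
  simp only [Set.mem_inter_iff, Set.mem_ofPred_eq, Set.mem_insert_iff, Set.mem_singleton_iff]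
  constructor
  · rintro ⟨hbx, hxa⟩
    obtain ⟨k, hk, h1 | h2 | h3⟩ := hsh.exists_map_triangle hM hT (hM.isD3Copy hab hbx hxa)
    · have := eq_of_eqOn_arc hstab hab hk IsAuto.refl (by simp [h1.1]) (by simp [h1.2.1])
      left
      rw [← h1.2.2, this]
      rfl
    · have := eq_of_eqOn_arc hstab hca hk hh (by rw [h2.2.2, hhc]) (by rw [h2.1, hha])
      right; right
      rw [← h2.2.1, this]
    · have := eq_of_eqOn_arc hstab hbc hk hg (by rw [h3.2.1, hgb]) (by rw [h3.2.2, hgc])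
      right; left
      rw [← h3.1, this]
  · rintro (rfl | rfl | rfl)
    · exact ⟨hbc, hca⟩
    · have h1 := (hg.1 _ _).1 hca
      have h2 := (hg.1 _ _).1 hab
      rw [hgc] at h1
      rw [hgb] at h2
      exact ⟨h1, h2⟩
    · have h1 := (hh.1 _ _).1 hab
      have h2 := (hh.1 _ _).1 hbc
      rw [hha] at h1
      rw [hhc] at h2
      exact ⟨h1, h2⟩

theorem ncard_common_of_rotation (hsh : M.SetHomogeneous) (hM : M.IsS)
    (hstab : ∀ α β : V, M.arc α β → ∀ g : V ≃ V, M.IsAuto g →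
      g α = α → g β = β → g = Equiv.refl V) {a b c : V} (hT : M.IsD3Copy a b c)
    {r : V ≃ V} (hr : M.IsAuto r) (ha : r a = b) (hb : r b = c) (hc : r c = a) :
    ({x | M.arc b x} ∩ {x | M.arc x a}).ncard = 1 := by
  have e1 : r.symm a = c := by rw [Equiv.symm_apply_eq, hc]
  have e2 : r.symm b = a := by rw [Equiv.symm_apply_eq, ha]
  have e3 : r.symm c = b := by rw [Equiv.symm_apply_eq, hb]
  rw [hsh.common_eq hM hstab hT hr.symm e2 e3 hr hc ha, e1, hb]
  simp

theorem ncard_common_of_no_rotation (hsh : M.SetHomogeneous) (hM : M.IsS)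
    (hstab : ∀ α β : V, M.arc α β → ∀ g : V ≃ V, M.IsAuto g →
      g α = α → g β = β → g = Equiv.refl V) {a b c : V} (hT : M.IsD3Copy a b c)
    (hno : ∀ r : V ≃ V, M.IsAuto r → r a = b → r b = c → r c ≠ a) :
    ({x | M.arc b x} ∩ {x | M.arc x a}).ncard = 3 := by
  have hTT := hT
  obtain ⟨-, -, -, hab, hbc, hca, -⟩ := hTT
  obtain ⟨g, hg, hgb, hgc⟩ := hsh.exists_map_arc hM hbc hab
  obtain ⟨h, hh, hhc, hha⟩ := hsh.exists_map_arc hM hca hab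
  rw [hsh.common_eq hM hstab hT hg hgb hgc hh hhc hha, Set.ncard_eq_three]
  refine ⟨c, g a, h b, fun e => ?_, fun e => ?_, fun e => ?_, rfl⟩
  · exact hno g.symm hg.symm (by rw [Equiv.symm_apply_eq, hgb])
      (by rw [Equiv.symm_apply_eq, hgc]) (by rw [Equiv.symm_apply_eq, e])
  · exact hno h hh hha e.symm hhc
  · refine hno (g.trans h.symm) (hg.trans hh.symm) ?_ ?_ ?_
    · rw [Equiv.trans_apply, Equiv.symm_apply_eq, e]
    · rw [Equiv.trans_apply, Equiv.symm_apply_eq, hgb, hhc]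
    · rw [Equiv.trans_apply, Equiv.symm_apply_eq, hgc, hha]

theorem ncard_inducedMaps_of_rotation (hM : M.IsS) {a b c : V} (hT : M.IsD3Copy a b c)
    {r : V ≃ V} (hr : M.IsAuto r) (ha : r a = b) (hb : r b = c) (hc : r c = a) :
    (M.inducedMaps {a, b, c}).ncard = 3 := by
  have hTT := hT
  obtain ⟨nab, nbc, nac, -⟩ := hTT
  rw [Set.ncard_eq_three]
  refine ⟨fun x => x, fun x => r x, fun x => r (r x), fun e => ?_, fun e => ?_, fun e => ?_, ?_⟩
  · have := congrFun e ⟨a, by simp⟩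
    exact nab (by simpa only [ha] using this)
  · have := congrFun e ⟨a, by simp⟩
    exact nac (by simpa only [ha, hb] using this)
  · have := congrFun e ⟨a, by simp⟩
    exact nbc (by simpa only [ha, hb] using this)
  · ext f
    simp only [Set.mem_insert_iff, Set.mem_singleton_iff]
    constructor
    · rintro ⟨g, hg, hgT, hf⟩
      rcases hg.cyclic_of_image_eq hM hT hT hgT with h | h | h
      · left
        ext ⟨x, hx⟩
        rw [hf]
        rcases hx with rfl | rfl | rfl <;> simp_all
      · right; left
        ext ⟨x, hx⟩
        rw [hf]
        rcases hx with rfl | rfl | rfl <;> simp_all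
      · right; right
        ext ⟨x, hx⟩
        rw [hf]
        rcases hx with rfl | rfl | rfl <;> simp_all
    · have cyc : ∀ x y z : V, ({y, z, x} : Set V) = {x, y, z} := by
        intro x y z
        ext w
        simp only [Set.mem_insert_iff, Set.mem_singleton_iff]
        tauto
      have hrT : ⇑r '' {a, b, c} = {a, b, c} := by
        rw [Set.image_insert_eq, Set.image_pair, ha, hb, hc, cyc]
      rintro (rfl | rfl | rfl)
      · exact ⟨Equiv.refl V, IsAuto.refl, by simp, fun _ => rfl⟩
      · exact ⟨r, hr, hrT, fun _ => rfl⟩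
      · refine ⟨r.trans r, hr.trans hr, ?_, fun _ => rfl⟩
        rw [Equiv.coe_trans, Set.image_comp, hrT, hrT]

theorem ncard_inducedMaps_of_no_rotation (hM : M.IsS) {a b c : V} (hT : M.IsD3Copy a b c)
    (hno : ∀ r : V ≃ V, M.IsAuto r → r a = b → r b = c → r c ≠ a) :
    (M.inducedMaps {a, b, c}).ncard = 1 := by
  rw [Set.ncard_eq_one]
  refine ⟨fun x => x, ?_⟩
  ext f
  rw [Set.mem_singleton_iff]
  constructor
  · rintro ⟨g, hg, hgT, hf⟩
    rcases hg.cyclic_of_image_eq hM hT hT hgT with h | h | h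
    · ext ⟨x, hx⟩
      rw [hf]
      rcases hx with rfl | rfl | rfl <;> simp_all
    · exact (hno g hg h.1 h.2.1 h.2.2).elim
    · refine (hno (g.trans g) (hg.trans hg) ?_ ?_ ?_).elim <;> simp [h]
  · rintro rfl
    exact ⟨Equiv.refl V, IsAuto.refl, by simp, fun _ => rfl⟩

/-- Each directed triangle `a → b → c → a` admits either no rotation or all rotations, and the
number of directed triangles on the arc `a → b` is `3` or `1` accordingly. -/
theorem SetHomogeneous.inducedMaps_cases (hsh : M.SetHomogeneous) (hM : M.IsS)
    (hstab : ∀ α β : V, M.arc α β → ∀ g : V ≃ V, M.IsAuto g →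
      g α = α → g β = β → g = Equiv.refl V) {a b c : V} (hT : M.IsD3Copy a b c) :
    ((M.inducedMaps {a, b, c}).ncard = 1 ∧ ({x | M.arc b x} ∩ {x | M.arc x a}).ncard = 3) ∨
    ((M.inducedMaps {a, b, c}).ncard = 3 ∧ ({x | M.arc b x} ∩ {x | M.arc x a}).ncard = 1) := by
  by_cases hno : ∀ r : V ≃ V, M.IsAuto r → r a = b → r b = c → r c ≠ a
  · exact Or.inl ⟨ncard_inducedMaps_of_no_rotation hM hT hno,
      ncard_common_of_no_rotation hsh hM hstab hT hno⟩
  · push Not at hno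
    obtain ⟨r, hr, ha, hb, hc⟩ := hno
    exact Or.inr ⟨ncard_inducedMaps_of_rotation hM hT hr ha hb hc,
      ncard_common_of_rotation hsh hM hstab hT hr ha hb hc⟩

end SDigraph

/-- Let `M` be a finite set-homogeneous s-digraph embedding
`D₃`, with trivial pointwise stabilizers of arcs.  Then: the group induced on
every copy of `D₃` by its setwise stabilizer is trivial iff
`|Γ(β) ∩ Γ*(α)| = 3` for every arc `α → β`; and it has order `3` on every
copy iff `|Γ(β) ∩ Γ*(α)| = 1` for every arc `α → β`. -/
theorem d3_stabilizer_dichotomy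
    {V : Type} [Fintype V] (M : SDigraph V) (hM : M.IsS)
    (hsh : M.SetHomogeneous)
    (hD3 : ∃ a b c : V, M.IsD3Copy a b c)
    (hstab : ∀ α β : V, M.arc α β → ∀ g : V ≃ V, M.IsAuto g →
      g α = α → g β = β → g = Equiv.refl V) :
    ((∀ a b c : V, M.IsD3Copy a b c →
        (M.inducedMaps {a, b, c}).ncard = 1) ↔
      ∀ α β : V, M.arc α β →
        ({x | M.arc β x} ∩ {x | M.arc x α}).ncard = 3) ∧
    ((∀ a b c : V, M.IsD3Copy a b c →
        (M.inducedMaps {a, b, c}).ncard = 3) ↔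
      ∀ α β : V, M.arc α β →
        ({x | M.arc β x} ∩ {x | M.arc x α}).ncard = 1) := by
  have key := fun {a b c : V} (hT : M.IsD3Copy a b c) => hsh.inducedMaps_cases hM hstab hT
  refine ⟨⟨fun h α β hαβ => ?_, fun h a b c hT => ?_⟩, ⟨fun h α β hαβ => ?_, fun h a b c hT => ?_⟩⟩
  · obtain ⟨γ, hT⟩ := hsh.exists_isD3Copy_of_arc hM hD3 hαβ
    have := h _ _ _ hT
    have := key hT
    omega
  · have := h a b hT.2.2.2.1
    have := key hT
    omega
  · obtain ⟨γ, hT⟩ := hsh.exists_isD3Copy_of_arc hM hD3 hαβ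
    have := h _ _ _ hT
    have := key hT
    omega
  · have := h a b hT.2.2.2.1
    have := key hT
    omega
end

section
/- The directed 5-cycle D_5 is a set-homogeneous a-digraph which is not homogeneous. -/
open ADigraph

namespace ADigraph

theorem dirCycle_five_arc (u v : ZMod 5) : (dirCycle 5).arc u v ↔ v = u + 1 := by
  change (v = u + 1 ∧ u ≠ v) ↔ v = u + 1
  revert u v
  decide

/-- An automorphism of the directed 5-cycle commutes with the successor map. -/
theorem IsAuto.map_add_one {g : ZMod 5 ≃ ZMod 5} (hg : (dirCycle 5).IsAuto g) (u : ZMod 5) :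
    g (u + 1) = g u + 1 :=
  (dirCycle_five_arc _ _).1 ((hg _ _).1 ((dirCycle_five_arc _ _).2 rfl))

theorem isAuto_addRight (k : ZMod 5) : (dirCycle 5).IsAuto (Equiv.addRight k) := by
  intro u v
  simp only [dirCycle_five_arc, Equiv.coe_addRight]
  rw [add_right_comm, add_left_inj]

set_option maxRecDepth 100000 in
/-- Up to rotation, a set of vertices of the directed 5-cycle is determined by its cardinality
and the number of arcs it induces. -/
theorem exists_rotation_of_card_eq : ∀ S T : Finset (ZMod 5), S.card = T.card →
    (S.filter (fun i => i + 1 ∈ S)).card = (T.filter (fun i => i + 1 ∈ T)).card →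
    ∃ k : ZMod 5, S.image (fun i => i + k) = T := by
  decide

/-- An isomorphism of induced subdigraphs does not decrease the number of vertices with an
out-neighbour inside the set. -/
theorem card_filter_succ_le {S T : Finset (ZMod 5)}
    (e : ↥(S : Set (ZMod 5)) → ↥(T : Set (ZMod 5))) (hinj : Function.Injective e)
    (he : ∀ u v : (S : Set (ZMod 5)), (v : ZMod 5) = u + 1 → (e v : ZMod 5) = e u + 1) :
    (S.filter (fun i => i + 1 ∈ S)).card ≤ (T.filter (fun i => i + 1 ∈ T)).card := by
  refine Finset.card_le_card_of_injOn (fun i => if h : i ∈ S then (e ⟨i, h⟩ : ZMod 5) else i) ?_ ?_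
  · intro i hi
    obtain ⟨hi, hi'⟩ := Finset.mem_filter.1 hi
    have h := he ⟨i, hi⟩ ⟨i + 1, hi'⟩ rfl
    simp only [hi, dite_true, Finset.coe_filter, Set.mem_ofPred_eq]
    exact ⟨(e ⟨i, hi⟩).2, h ▸ (e ⟨i + 1, hi'⟩).2⟩
  · intro i hi j hj hij
    have hi := (Finset.mem_filter.1 hi).1
    have hj := (Finset.mem_filter.1 hj).1
    simp only [hi, hj, dite_true] at hij
    exact congrArg Subtype.val (hinj (Subtype.ext hij))

theorem dirCycle_five_isA : (dirCycle 5).IsA := by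
  simp only [IsA, dirCycle_five_arc]
  decide

theorem dirCycle_five_setHomogeneous : (dirCycle 5).SetHomogeneous := by
  rintro U U' hU hU' ⟨e, he⟩
  lift U to Finset (ZMod 5) using hU
  lift U' to Finset (ZMod 5) using hU'
  have he' : ∀ u v : (U : Set (ZMod 5)),
      (v : ZMod 5) = u + 1 ↔ (e v : ZMod 5) = e u + 1 := fun u v => by
    rw [← dirCycle_five_arc, ← dirCycle_five_arc]
    exact he u v
  have hcard : U.card = U'.card := Finset.card_eq_of_equiv e
  obtain ⟨k, hk⟩ := exists_rotation_of_card_eq U U' hcard (le_antisymm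
    (card_filter_succ_le e e.injective fun u v => (he' u v).1)
    (card_filter_succ_le e.symm e.symm.injective fun u v h =>
      (he' _ _).2 (by simpa using h)))
  refine ⟨Equiv.addRight k, isAuto_addRight k, ?_⟩
  rw [← hk, Finset.coe_image]
  rfl

/-- Swapping the two non-adjacent vertices `0` and `2` does not extend to an automorphism. -/
theorem dirCycle_five_not_homogeneous : ¬ (dirCycle 5).Homogeneous := by
  intro h
  have hmem : ∀ x : ZMod 5, x ∈ ({0, 2} : Set (ZMod 5)) ↔
      Equiv.swap 0 2 x ∈ ({0, 2} : Set (ZMod 5)) := by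
    simp only [Set.mem_insert_iff, Set.mem_singleton_iff]
    decide
  obtain ⟨g, hg, hge⟩ := h {0, 2} {0, 2} (Set.toFinite _) (Set.toFinite _)
    ((Equiv.swap 0 2).subtypeEquiv hmem) (by
      rintro ⟨u, rfl | rfl⟩ ⟨v, rfl | rfl⟩ <;>
        simp only [dirCycle_five_arc, Equiv.subtypeEquiv_apply] <;> decide)
  have h0 : g 0 = 2 := hge ⟨0, by simp⟩
  have h2 : g (0 + 1 + 1) = 0 := hge ⟨2, by simp⟩
  rw [hg.map_add_one, hg.map_add_one, h0] at h2
  exact absurd h2 (by decide)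

end ADigraph

/-- The directed 5-cycle `D₅` is a set-homogeneous
a-digraph which is not homogeneous. -/
theorem dirCycle_five_set_homogeneous_not_homogeneous :
    (dirCycle 5).IsA ∧ (dirCycle 5).SetHomogeneous ∧
      ¬ (dirCycle 5).Homogeneous := by
  exact ⟨dirCycle_five_isA, dirCycle_five_setHomogeneous, dirCycle_five_not_homogeneous⟩
end
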